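/- arXiv:2303.10658 — 3 statements merged into one kernel-verified Lean document; each statement's English description precedes it below -/
import Mathlib

section
/- Let {F¹²,F¹³,F²³} be a compatible triple of fundamental matrices. Then the solution is unique up to projective transformation — i.e., for any two solutions (P₁,P₂,P₃) and (Q₁,Q₂,Q₃) there exist H ∈ GL₄(ℝ) and nonzero scalars μ₁,μ₂,μ₃ with Qᵢ = μᵢ Pᵢ H for i = 1,2,3 — if and only if the two epipoles in each image are distinct, i.e., e₁² is not parallel to e₁³, e₂¹ is not parallel to e₂³, and e₃¹ is not parallel to e₃². -/
open Matrix

/-- The 6×6 matrix whose first three rows form the block `[P₁ | x | 0]` and whose last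
three rows form the block `[P₂ | 0 | y]`. -/
noncomputable def bigMat (P₁ P₂ : Matrix (Fin 3) (Fin 4) ℝ) (x y : Fin 3 → ℝ) :
    Matrix (Fin 6) (Fin 6) ℝ :=
  fun i j =>
    if hi : (i : ℕ) < 3 then
      if hj : (j : ℕ) < 4 then P₁ ⟨(i : ℕ), hi⟩ ⟨(j : ℕ), hj⟩
      else if (j : ℕ) = 4 then x ⟨(i : ℕ), hi⟩ else 0
    else
      if hj : (j : ℕ) < 4 then P₂ ⟨(i : ℕ) - 3, by have := i.isLt; omega⟩ ⟨(j : ℕ), hj⟩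
      else if (j : ℕ) = 4 then 0
      else y ⟨(i : ℕ) - 3, by have := i.isLt; omega⟩

/-- `psi P₁ P₂` is the unique 3×3 matrix `F` such that for all `x y : ℝ³`,
`xᵀ F y = det [P₁ | x | 0; P₂ | 0 | y]`.  (Since the determinant is bilinear in `(x, y)`,
this matrix is obtained by evaluating at pairs of standard basis vectors.) -/
noncomputable def psi (P₁ P₂ : Matrix (Fin 3) (Fin 4) ℝ) : Matrix (Fin 3) (Fin 3) ℝ :=
  fun a b => (bigMat P₁ P₂ (Pi.single a 1) (Pi.single b 1)).det

/-- A camera is a real 3×4 matrix of rank 3. -/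
def IsCamera (P : Matrix (Fin 3) (Fin 4) ℝ) : Prop := P.rank = 3

/-- `P₁, P₂, P₃` is a solution of the triple `{F¹², F¹³, F²³}` of fundamental matrices. -/
def IsSolution3 (F12 F13 F23 : Matrix (Fin 3) (Fin 3) ℝ)
    (P₁ P₂ P₃ : Matrix (Fin 3) (Fin 4) ℝ) : Prop :=
  IsCamera P₁ ∧ IsCamera P₂ ∧ IsCamera P₃ ∧
    ∃ l12 l13 l23 : ℝ, l12 ≠ 0 ∧ l13 ≠ 0 ∧ l23 ≠ 0 ∧
      l12 • F12 = psi P₁ P₂ ∧ l13 • F13 = psi P₁ P₃ ∧ l23 • F23 = psi P₂ P₃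


lemma ker_line {m n : ℕ} (M : Matrix (Fin m) (Fin n) ℝ) (h : M.rank + 1 = n) :
    ∃ c : Fin n → ℝ, c ≠ 0 ∧ M *ᵥ c = 0 ∧ ∀ x, M *ᵥ x = 0 → ∃ k : ℝ, x = k • c := by
  have h1 := LinearMap.finrank_range_add_finrank_ker M.mulVecLin
  rw [Module.finrank_fin_fun] at h1
  have h2 : Module.finrank ℝ (LinearMap.ker M.mulVecLin) = 1 := by
    unfold Matrix.rank at h; omega
  obtain ⟨⟨c, hc⟩, hc0, hall⟩ := finrank_eq_one_iff'.1 h2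
  refine ⟨c, fun h => hc0 (Subtype.ext h), by simpa using hc, fun x hx => ?_⟩
  obtain ⟨k, hk⟩ := hall ⟨x, by simpa using hx⟩
  exact ⟨k, by simpa using (congrArg Subtype.val hk).symm⟩

lemma ker_par {m n : ℕ} (M : Matrix (Fin m) (Fin n) ℝ) (h : M.rank + 1 = n)
    (e f : Fin n → ℝ) (he0 : e ≠ 0) (he : M *ᵥ e = 0) (hf : M *ᵥ f = 0) :
    ∃ k : ℝ, f = k • e := by
  obtain ⟨c, -, -, hall⟩ := ker_line M h
  obtain ⟨a, ha⟩ := hall e he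
  obtain ⟨b, hb⟩ := hall f hf
  have ha0 : a ≠ 0 := by rintro rfl; simp at ha; exact he0 ha
  refine ⟨b / a, ?_⟩
  rw [ha, hb, smul_smul, div_mul_cancel₀ _ ha0]

lemma cam_left (P : Matrix (Fin 3) (Fin 4) ℝ) (h : IsCamera P) (y : Fin 3 → ℝ)
    (hy : y ᵥ* P = 0) : y = 0 := by
  have h2 : Pᵀ.rank = 3 := by rw [Matrix.rank_transpose]; exact h
  have h1 := LinearMap.finrank_range_add_finrank_ker Pᵀ.mulVecLin
  rw [Module.finrank_fin_fun] at h1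
  have h3 : Module.finrank ℝ (LinearMap.ker Pᵀ.mulVecLin) = 0 := by
    unfold Matrix.rank at h2; omega
  rw [Submodule.finrank_eq_zero] at h3
  have : y ∈ LinearMap.ker Pᵀ.mulVecLin := by
    simp [Matrix.mulVec_transpose, hy]
  rw [h3] at this
  simpa using this

def Kmat (H : Matrix (Fin 4) (Fin 4) ℝ) : Matrix (Fin 6) (Fin 6) ℝ :=
  Matrix.reindex (finSumFinEquiv (m := 4) (n := 2)) (finSumFinEquiv (m := 4) (n := 2))
    (Matrix.fromBlocks H 0 0 1)

lemma Kmat_det (H : Matrix (Fin 4) (Fin 4) ℝ) : (Kmat H).det = H.det := by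
  unfold Kmat
  rw [Matrix.det_reindex_self, Matrix.det_fromBlocks_zero₂₁]; simp

lemma Kmat_ll (H) (i j : Fin 4) : Kmat H (Fin.castAdd 2 i) (Fin.castAdd 2 j) = H i j := by
  unfold Kmat
  rw [Matrix.reindex_apply, Matrix.submatrix_apply, finSumFinEquiv_symm_apply_castAdd, finSumFinEquiv_symm_apply_castAdd]
  rfl
lemma Kmat_lr (H) (i : Fin 4) (j : Fin 2) : Kmat H (Fin.castAdd 2 i) (Fin.natAdd 4 j) = 0 := by
  unfold Kmat
  rw [Matrix.reindex_apply, Matrix.submatrix_apply, finSumFinEquiv_symm_apply_castAdd, finSumFinEquiv_symm_apply_natAdd]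
  rfl
lemma Kmat_rl (H) (i : Fin 2) (j : Fin 4) : Kmat H (Fin.natAdd 4 i) (Fin.castAdd 2 j) = 0 := by
  unfold Kmat
  rw [Matrix.reindex_apply, Matrix.submatrix_apply, finSumFinEquiv_symm_apply_natAdd, finSumFinEquiv_symm_apply_castAdd]
  rfl
lemma Kmat_rr (H) (i : Fin 2) (j : Fin 2) : Kmat H (Fin.natAdd 4 i) (Fin.natAdd 4 j) =
    (1 : Matrix (Fin 2) (Fin 2) ℝ) i j := by
  unfold Kmat
  rw [Matrix.reindex_apply, Matrix.submatrix_apply, finSumFinEquiv_symm_apply_natAdd, finSumFinEquiv_symm_apply_natAdd]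
  rfl

lemma sum_six (f : Fin 6 → ℝ) : ∑ i, f i =
    ∑ i : Fin 4, f (Fin.castAdd 2 i) + ∑ i : Fin 2, f (Fin.natAdd 4 i) :=
  Fin.sum_univ_add (a := 4) (b := 2) f

lemma bigMat_mul (P₁ P₂ : Matrix (Fin 3) (Fin 4) ℝ) (H : Matrix (Fin 4) (Fin 4) ℝ) (x y) :
    bigMat (P₁ * H) (P₂ * H) x y = bigMat P₁ P₂ x y * Kmat H := by
  ext i j
  rw [Matrix.mul_apply, sum_six]
  induction j using Fin.addCases (m := 4) (n := 2) with
  | left j =>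
    simp only [Kmat_ll, Kmat_rl, bigMat]
    by_cases hi : (i : ℕ) < 3 <;> simp [hi, Matrix.mul_apply]
  | right j =>
    simp only [Kmat_lr, Kmat_rr, bigMat]
    by_cases hi : (i : ℕ) < 3 <;> fin_cases j <;> simp [hi, Matrix.one_apply]

lemma psi_mul (P₁ P₂ : Matrix (Fin 3) (Fin 4) ℝ) (H : Matrix (Fin 4) (Fin 4) ℝ) :
    psi (P₁ * H) (P₂ * H) = H.det • psi P₁ P₂ := by
  ext a b
  simp [psi, bigMat_mul, Kmat_det, mul_comm]

lemma psi_mulVec (P₁ P₂ : Matrix (Fin 3) (Fin 4) ℝ) (y : Fin 3 → ℝ) (a : Fin 3) :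
    (psi P₁ P₂ *ᵥ y) a = (bigMat P₁ P₂ (Pi.single a 1) y).det := by
  simp only [Matrix.mulVec, dotProduct, psi]
  have aux : ∃ G : Fin 6 → ℝ, ∀ z, (bigMat P₁ P₂ (Pi.single a 1) z).det =
      ∑ i, G i * bigMat P₁ P₂ (Pi.single a 1) z i 5 := by
    refine ⟨fun i => (-1) ^ ((i : ℕ) + 5) * ((bigMat P₁ P₂ (Pi.single a 1) 0).submatrix i.succAbove
      (Fin.succAbove 5)).det, fun z => ?_⟩
    rw [Matrix.det_succ_column _ 5]
    refine Finset.sum_congr rfl fun i _ => ?_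
    have : (bigMat P₁ P₂ (Pi.single a 1) z).submatrix i.succAbove (Fin.succAbove 5) =
        (bigMat P₁ P₂ (Pi.single a 1) 0).submatrix i.succAbove (Fin.succAbove 5) := by
      ext u v
      fin_cases v <;> simp [bigMat, Fin.succAbove]
    rw [this, mul_right_comm]
    rfl
  obtain ⟨G, hG⟩ := aux
  rw [hG y, Fin.sum_univ_three, hG, hG, hG]
  simp only [Fin.sum_univ_six]
  simp [bigMat]

lemma psi_vecMul (P₁ P₂ : Matrix (Fin 3) (Fin 4) ℝ) (x : Fin 3 → ℝ) (b : Fin 3) :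
    ((psi P₁ P₂)ᵀ *ᵥ x) b = (bigMat P₁ P₂ x (Pi.single b 1)).det := by
  simp only [Matrix.mulVec, dotProduct, psi, Matrix.transpose_apply]
  have aux : ∃ G : Fin 6 → ℝ, ∀ z, (bigMat P₁ P₂ z (Pi.single b 1)).det =
      ∑ i, G i * bigMat P₁ P₂ z (Pi.single b 1) i 4 := by
    refine ⟨fun i => (-1) ^ ((i : ℕ) + 4) * ((bigMat P₁ P₂ 0 (Pi.single b 1)).submatrix i.succAbove
      (Fin.succAbove 4)).det, fun z => ?_⟩
    rw [Matrix.det_succ_column _ 4]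
    refine Finset.sum_congr rfl fun i _ => ?_
    have : (bigMat P₁ P₂ z (Pi.single b 1)).submatrix i.succAbove (Fin.succAbove 4) =
        (bigMat P₁ P₂ 0 (Pi.single b 1)).submatrix i.succAbove (Fin.succAbove 4) := by
      ext u v
      fin_cases v <;> simp [bigMat, Fin.succAbove]
    rw [this, mul_right_comm]
    rfl
  obtain ⟨G, hG⟩ := aux
  rw [hG x, Fin.sum_univ_three, hG, hG, hG]
  simp only [Fin.sum_univ_six]
  simp [bigMat]

lemma bigMat_mulVec_top (P₁ P₂ : Matrix (Fin 3) (Fin 4) ℝ) (x y : Fin 3 → ℝ) (c : Fin 4 → ℝ) (s t : ℝ)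
    (h1 : P₁ *ᵥ c + s • x = 0) (h2 : P₂ *ᵥ c + t • y = 0) (hc : c ≠ 0) :
    (bigMat P₁ P₂ x y).det = 0 := by
  refine Matrix.exists_mulVec_eq_zero_iff.1 ⟨Fin.append (m := 4) (n := 2) c ![s, t], ?_, ?_⟩
  · intro h
    apply hc
    ext i
    have := congrFun h (Fin.castAdd 2 i)
    rw [Fin.append_left] at this
    exact this
  · ext i
    simp only [Matrix.mulVec, dotProduct]
    rw [sum_six]
    simp only [Fin.append_left, Fin.append_right, bigMat]
    by_cases hi : (i : ℕ) < 3
    · have := congrFun h1 ⟨i, hi⟩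
      simp [hi, Matrix.mulVec, dotProduct] at this ⊢
      linarith
    · have := congrFun h2 ⟨i - 3, by omega⟩
      simp [hi, Matrix.mulVec, dotProduct] at this ⊢
      linarith

lemma psi_epi (P₁ P₂ : Matrix (Fin 3) (Fin 4) ℝ) (c : Fin 4 → ℝ) (hc : c ≠ 0) (h : P₁ *ᵥ c = 0) :
    psi P₁ P₂ *ᵥ (P₂ *ᵥ c) = 0 := by
  ext a
  rw [psi_mulVec]
  exact bigMat_mulVec_top _ _ _ _ c 0 (-1) (by simp [h]) (by simp) hc

lemma psi_epi' (P₁ P₂ : Matrix (Fin 3) (Fin 4) ℝ) (c : Fin 4 → ℝ) (hc : c ≠ 0) (h : P₂ *ᵥ c = 0) :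
    (psi P₁ P₂)ᵀ *ᵥ (P₁ *ᵥ c) = 0 := by
  ext a
  rw [psi_vecMul]
  exact bigMat_mulVec_top _ _ _ _ c (-1) 0 (by simp) (by simp [h]) hc

lemma psi_zero (P₁ P₂ : Matrix (Fin 3) (Fin 4) ℝ) (c : Fin 4 → ℝ) (hc : c ≠ 0) (h : P₁ *ᵥ c = 0)
    (h' : P₂ *ᵥ c = 0) : psi P₁ P₂ = 0 := by
  ext a b
  exact bigMat_mulVec_top _ _ _ _ c 0 0 (by simp [h]) (by simp [h']) hc

/-- the standard camera -/
def Emat : Matrix (Fin 3) (Fin 4) ℝ := !![1,0,0,0;0,1,0,0;0,0,1,0]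

set_option maxHeartbeats 1000000 in
lemma det_E (R : Matrix (Fin 3) (Fin 4) ℝ) (x y : Fin 3 → ℝ) :
    (bigMat Emat R x y).det = (crossProduct (fun j => R j 0 * x 0 + R j 1 * x 1 + R j 2 * x 2)
      (fun j => R j 3)) ⬝ᵥ y := by
  have hB : bigMat Emat R x y = !![1,0,0,0,x 0,0; 0,1,0,0,x 1,0; 0,0,1,0,x 2,0;
      R 0 0, R 0 1, R 0 2, R 0 3, 0, y 0; R 1 0, R 1 1, R 1 2, R 1 3, 0, y 1;
      R 2 0, R 2 1, R 2 2, R 2 3, 0, y 2] := by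
    ext i j; fin_cases i <;> fin_cases j <;> rfl
  rw [hB]
  simp only [dotProduct, Fin.sum_univ_three, cross_apply]
  simp [Matrix.det_succ_row_zero, Fin.sum_univ_succ, Fin.succAbove]
  ring

lemma psi_E (R : Matrix (Fin 3) (Fin 4) ℝ) (i : Fin 3) :
    psi Emat R i = crossProduct (fun j => R j i.castSucc) (fun j => R j 3) := by
  ext b
  unfold psi
  rw [det_E]
  fin_cases i <;> simp

lemma cam_normal (P : Matrix (Fin 3) (Fin 4) ℝ) (h : IsCamera P) :
    ∃ H : Matrix (Fin 4) (Fin 4) ℝ, H.det ≠ 0 ∧ P = Emat * H := by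
  obtain ⟨c, hc0, hc, hall⟩ := ker_line P (by unfold IsCamera at h; omega)
  refine ⟨Matrix.of ![P 0, P 1, P 2, c], ?_, ?_⟩
  · intro hdet
    obtain ⟨v, hv0, hv⟩ := Matrix.exists_mulVec_eq_zero_iff.2 hdet
    have h0 := congrFun hv 0
    have h1 := congrFun hv 1
    have h2 := congrFun hv 2
    have h3 := congrFun hv 3
    simp [Matrix.mulVec] at h0 h1 h2 h3
    have hP : P *ᵥ v = 0 := by
      ext i; fin_cases i
      · exact h0
      · exact h1
      · exact h2
    obtain ⟨k, hk⟩ := hall v hP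
    rw [hk, dotProduct_smul, smul_eq_mul, mul_eq_zero, dotProduct_self_eq_zero] at h3
    rcases h3 with h3 | h3
    · apply hv0; rw [hk, h3, zero_smul]
    · exact hc0 h3
  · ext i j
    fin_cases i <;> simp [Emat, Matrix.mul_apply, Fin.sum_univ_succ]

lemma cross_zero (u a : Fin 3 → ℝ) (ha : a ≠ 0) (h : crossProduct u a = 0) : ∃ k : ℝ, u = k • a := by
  have h0 := congrFun h 0
  have h1 := congrFun h 1
  have h2 := congrFun h 2
  simp [cross_apply] at h0 h1 h2
  have : ∃ i, a i ≠ 0 := by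
    by_contra hh; push Not at hh; exact ha (funext hh)
  obtain ⟨i, hi⟩ := this
  refine ⟨u i / a i, ?_⟩
  ext j
  rw [Pi.smul_apply, smul_eq_mul]
  field_simp
  fin_cases i <;> fin_cases j <;> simp at * <;> linarith

/-- Two pairs of cameras with the same fundamental matrix are projectively equivalent. -/
lemma pair_unique (P₁ P₂ Q₁ Q₂ : Matrix (Fin 3) (Fin 4) ℝ) (F : Matrix (Fin 3) (Fin 3) ℝ)
    (hF : F.rank = 2) (hP : IsCamera P₁) (hQ : IsCamera Q₁) (l m : ℝ) (hl : l ≠ 0) (hm : m ≠ 0)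
    (hlP : l • F = psi P₁ P₂) (hmQ : m • F = psi Q₁ Q₂) :
    ∃ (H : Matrix (Fin 4) (Fin 4) ℝ) (β : ℝ), H.det ≠ 0 ∧ β ≠ 0 ∧ Q₁ = P₁ * H ∧
      Q₂ = β • (P₂ * H) := by
  obtain ⟨H1, hH1, rfl⟩ := cam_normal P₁ hP
  obtain ⟨H2, hH2, rfl⟩ := cam_normal Q₁ hQ
  have u1 : IsUnit H1.det := isUnit_iff_ne_zero.2 hH1
  have u2 : IsUnit H2.det := isUnit_iff_ne_zero.2 hH2
  obtain ⟨R, rfl⟩ : ∃ R, P₂ = R * H1 := ⟨P₂ * H1⁻¹, by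
    rw [Matrix.mul_assoc, Matrix.nonsing_inv_mul _ u1, Matrix.mul_one]⟩
  obtain ⟨S, rfl⟩ : ∃ S, Q₂ = S * H2 := ⟨Q₂ * H2⁻¹, by
    rw [Matrix.mul_assoc, Matrix.nonsing_inv_mul _ u2, Matrix.mul_one]⟩
  rw [psi_mul] at hlP hmQ
  have hF0 : F ≠ 0 := by rintro rfl; simp at hF
  obtain ⟨p, hp, hpF⟩ : ∃ p : ℝ, p ≠ 0 ∧ psi Emat R = p • F :=
    ⟨H1.det⁻¹ * l, by positivity, by rw [mul_smul, hlP, smul_smul, inv_mul_cancel₀ hH1, one_smul]⟩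
  obtain ⟨q, hq, hqF⟩ : ∃ q : ℝ, q ≠ 0 ∧ psi Emat S = q • F :=
    ⟨H2.det⁻¹ * m, by positivity, by rw [mul_smul, hmQ, smul_smul, inv_mul_cancel₀ hH2, one_smul]⟩
  set a : Fin 3 → ℝ := fun j => R j 3 with ha
  set b : Fin 3 → ℝ := fun j => S j 3 with hb
  have epi : ∀ (R : Matrix (Fin 3) (Fin 4) ℝ), psi Emat R *ᵥ (fun j => R j 3) = 0 := by
    intro R
    ext i
    simp only [Matrix.mulVec]
    rw [psi_E, dotProduct_comm, dot_cross_self]; rfl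
  have hFa : F *ᵥ a = 0 := by
    have := epi R
    rw [hpF, Matrix.smul_mulVec] at this
    exact (smul_eq_zero.1 this).resolve_left hp
  have hFb : F *ᵥ b = 0 := by
    have := epi S
    rw [hqF, Matrix.smul_mulVec] at this
    exact (smul_eq_zero.1 this).resolve_left hq
  have ha0 : a ≠ 0 := by
    intro h0
    apply hF0
    refine (smul_eq_zero.1 (?_ : p • F = 0)).resolve_left hp
    rw [← hpF]; funext i; rw [psi_E, ← ha, h0]; simp; rfl
  have hb0 : b ≠ 0 := by
    intro h0
    apply hF0
    refine (smul_eq_zero.1 (?_ : q • F = 0)).resolve_left hq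
    rw [← hqF]; funext i; rw [psi_E, ← hb, h0]; simp; rfl
  obtain ⟨κ, hκ⟩ := ker_par F (by omega) a b ha0 hFa hFb
  have hκ0 : κ ≠ 0 := by rintro rfl; simp at hκ; exact hb0 hκ
  have hcol : ∀ i : Fin 3, ∃ k : ℝ, (q • (fun j => R j i.castSucc) - (p * κ) • (fun j => S j i.castSucc))
      = k • a := by
    intro i
    apply cross_zero _ _ ha0
    have e1 : crossProduct (fun j => R j i.castSucc) a = p • F i := by
      rw [← psi_E, hpF]; rfl
    have e2 : crossProduct (fun j => S j i.castSucc) b = q • F i := by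
      rw [← psi_E, hqF]; rfl
    rw [hκ, map_smul] at e2
    rw [map_sub, LinearMap.sub_apply, map_smul, map_smul, LinearMap.smul_apply, LinearMap.smul_apply,
      e1, mul_smul, e2, smul_smul, smul_smul, mul_comm, sub_self]
  choose k hk using hcol
  -- S_i = (q/(pκ)) R_i - k_i/(pκ) a
  let β : ℝ := q / (p * κ)
  have hβ : β ≠ 0 := by simp only [β]; positivity
  let T : Matrix (Fin 4) (Fin 4) ℝ := !![1,0,0,0;0,1,0,0;0,0,1,0; -k 0 / q, -k 1 / q, -k 2 / q, κ / β]
  have hT : T.det ≠ 0 := by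
    have : T.det = κ / β := by
      simp [T, Matrix.det_succ_row_zero, Fin.sum_univ_succ, Fin.succAbove]
    rw [this]; positivity
  have hET : Emat * T = Emat := by
    ext i j
    fin_cases i <;> fin_cases j <;> simp [Emat, T, Matrix.mul_apply, Fin.sum_univ_succ]
  have hS : S = β • (R * T) := by
    ext i j
    have hbi := congrFun hκ i
    have hk0 := congrFun (hk 0) i
    have hk1 := congrFun (hk 1) i
    have hk2 := congrFun (hk 2) i
    simp [a, b] at hbi hk0 hk1 hk2
    fin_cases j <;>
      simp [T, Matrix.mul_apply, Fin.sum_univ_four]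
    · simp only [β]; field_simp; linarith
    · simp only [β]; field_simp; linarith
    · simp only [β]; field_simp; linarith
    · rw [hbi]; field_simp
  refine ⟨H1⁻¹ * T * H2, β, ?_, hβ, ?_, ?_⟩
  · rw [Matrix.det_mul, Matrix.det_mul, Matrix.det_nonsing_inv, Ring.inverse_eq_inv']
    positivity
  · rw [Matrix.mul_assoc, ← Matrix.mul_assoc H1, ← Matrix.mul_assoc H1, Matrix.mul_nonsing_inv _ u1,
      Matrix.one_mul, ← Matrix.mul_assoc, hET]
  · rw [Matrix.mul_assoc, ← Matrix.mul_assoc H1, ← Matrix.mul_assoc H1, Matrix.mul_nonsing_inv _ u1,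
      Matrix.one_mul, ← Matrix.mul_assoc]
    nth_rw 1 [hS]
    rw [Matrix.smul_mul]

lemma cam_outer (P : Matrix (Fin 3) (Fin 4) ℝ) (h : IsCamera P) (c : Fin 4 → ℝ) (hc0 : c ≠ 0)
    (hc : P *ᵥ c = 0) (M : Matrix (Fin 4) (Fin 4) ℝ) (hM : P * M = 0) :
    ∃ v : Fin 4 → ℝ, M = vecMulVec c v := by
  have : ∀ j, ∃ k : ℝ, (fun i => M i j) = k • c := by
    intro j
    refine ker_par P (by unfold IsCamera at h; omega) c _ hc0 hc ?_
    ext i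
    exact congrFun (congrFun hM i) j
  choose v hv using this
  refine ⟨v, ?_⟩
  ext i j
  have := congrFun (hv j) i
  simp [vecMulVec_apply] at this ⊢
  rw [this, mul_comm]

/-- If a scalar multiple of a camera has the form `a vᵀ - b wᵀ`, the scalar is zero. -/
lemma cam_rank (P : Matrix (Fin 3) (Fin 4) ℝ) (h : IsCamera P) (a b : Fin 3 → ℝ) (v w : Fin 4 → ℝ)
    (s : ℝ) (hs : s • P = vecMulVec a v - vecMulVec b w) : s = 0 := by
  by_contra hs0
  obtain ⟨n, hn0, hn⟩ : ∃ n : Fin 3 → ℝ, n ≠ 0 ∧ Matrix.of ![a, b, 0] *ᵥ n = 0 := by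
    apply Matrix.exists_mulVec_eq_zero_iff.2
    exact Matrix.det_eq_zero_of_row_eq_zero 2 (by intro j; rfl)
  have h1 := congrFun hn 0
  have h2 := congrFun hn 1
  simp [Matrix.mulVec] at h1 h2
  apply hn0
  apply cam_left P h
  have : s • (n ᵥ* P) = 0 := by
    rw [← Matrix.vecMul_smul, hs, Matrix.vecMul_sub, Matrix.vecMul_vecMulVec, Matrix.vecMul_vecMulVec,
      dotProduct_comm, h1, dotProduct_comm, h2]
    simp
  exact (smul_eq_zero.1 this).resolve_left hs0

lemma outer_ind {n : ℕ} (a b : Fin n → ℝ) (v w : Fin 4 → ℝ) (hb0 : b ≠ 0)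
    (hab : ¬ ∃ c : ℝ, a = c • b) (h : vecMulVec a v = vecMulVec b w) : v = 0 ∧ w = 0 := by
  have hv : v = 0 := by
    ext j
    by_contra hv
    change v j ≠ 0 at hv
    apply hab
    refine ⟨w j / v j, ?_⟩
    ext i
    have := congrFun (congrFun h i) j
    simp [vecMulVec_apply] at this ⊢
    field_simp
    linarith
  refine ⟨hv, ?_⟩
  subst hv
  obtain ⟨i, hi⟩ := Function.ne_iff.1 hb0
  ext j
  have := congrFun (congrFun h i) j
  simp [vecMulVec_apply] at this hi ⊢
  exact this.resolve_left hi

lemma core_unique (F12 F13 F23 : Matrix (Fin 3) (Fin 3) ℝ)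
    (hF12 : F12.rank = 2) (hF13 : F13.rank = 2) (hF23 : F23.rank = 2)
    (P₁ P₂ P₃ Q₁ Q₂ Q₃ : Matrix (Fin 3) (Fin 4) ℝ) (hP : IsSolution3 F12 F13 F23 P₁ P₂ P₃)
    (hQ : IsSolution3 F12 F13 F23 Q₁ Q₂ Q₃) (c1 c2 : Fin 4 → ℝ) (hc10 : c1 ≠ 0) (hc20 : c2 ≠ 0)
    (hc1 : P₁ *ᵥ c1 = 0) (hc2 : P₂ *ᵥ c2 = 0) (h32 : P₃ *ᵥ c2 ≠ 0)
    (hpar : ¬ ∃ c : ℝ, P₃ *ᵥ c1 = c • (P₃ *ᵥ c2)) :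
    ∃ (H : Matrix (Fin 4) (Fin 4) ℝ) (μ₁ μ₂ μ₃ : ℝ),
          H.det ≠ 0 ∧ μ₁ ≠ 0 ∧ μ₂ ≠ 0 ∧ μ₃ ≠ 0 ∧
          Q₁ = μ₁ • (P₁ * H) ∧ Q₂ = μ₂ • (P₂ * H) ∧ Q₃ = μ₃ • (P₃ * H) := by
  obtain ⟨p1, p2, p3, l12, l13, l23, hl12, hl13, hl23, e12, e13, e23⟩ := hP
  obtain ⟨q1, q2, q3, m12, m13, m23, hm12, hm13, hm23, f12, f13, f23⟩ := hQ
  obtain ⟨H, β, hH, hβ, A1, A2⟩ := pair_unique _ _ _ _ _ hF12 p1 q1 _ _ hl12 hm12 e12 f12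
  obtain ⟨H', γ, hH', hγ, B1, B3⟩ := pair_unique _ _ _ _ _ hF13 p1 q1 _ _ hl13 hm13 e13 f13
  obtain ⟨H'', δ, hH'', hδ, C2, C3⟩ := pair_unique _ _ _ _ _ hF23 p2 q2 _ _ hl23 hm23 e23 f23
  obtain ⟨v, hv⟩ := cam_outer P₁ p1 c1 hc10 hc1 (H' - H) (by rw [Matrix.mul_sub, ← B1, ← A1, sub_self])
  obtain ⟨w, hw⟩ := cam_outer P₂ p2 c2 hc20 hc2 (H'' - β • H)
    (by rw [Matrix.mul_sub, ← C2, Matrix.mul_smul, ← A2, sub_self])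
  have u : IsUnit H.det := isUnit_iff_ne_zero.2 hH
  have hv' : H' = H + vecMulVec c1 v := by rw [← hv]; abel
  have hw' : H'' = β • H + vecMulVec c2 w := by rw [← hw]; abel
  have key : γ • (P₃ * H) + γ • vecMulVec (P₃ *ᵥ c1) v =
      (δ * β) • (P₃ * H) + δ • vecMulVec (P₃ *ᵥ c2) w := by
    have := B3.symm.trans C3
    rw [hv', hw', Matrix.mul_add, Matrix.mul_add, Matrix.mul_vecMulVec, Matrix.mul_vecMulVec,
      Matrix.mul_smul, smul_add, smul_add, smul_smul] at this
    exact this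
  have key2 : (γ - δ * β) • P₃ = vecMulVec (P₃ *ᵥ c2) (δ • (w ᵥ* H⁻¹)) -
      vecMulVec (P₃ *ᵥ c1) (γ • (v ᵥ* H⁻¹)) := by
    have h1 : (γ - δ * β) • (P₃ * H) = δ • vecMulVec (P₃ *ᵥ c2) w - γ • vecMulVec (P₃ *ᵥ c1) v := by
      rw [sub_smul, sub_eq_sub_iff_add_eq_add, key, add_comm]
    have h2 := congrArg (· * H⁻¹) h1
    simp only [Matrix.smul_mul, Matrix.sub_mul, Matrix.mul_assoc, Matrix.mul_nonsing_inv _ u,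
      Matrix.mul_one, Matrix.vecMulVec_mul] at h2
    rw [h2, Matrix.vecMulVec_smul, Matrix.vecMulVec_smul]
  have hs := cam_rank P₃ p3 _ _ _ _ _ key2
  have hγδ : γ = δ * β := sub_eq_zero.1 hs
  rw [← hγδ, add_right_inj, ← Matrix.vecMulVec_smul, ← Matrix.vecMulVec_smul] at key
  have hz := (outer_ind _ _ _ _ h32 hpar key).1
  have hv0 : v = 0 := (smul_eq_zero.1 hz).resolve_left hγ
  refine ⟨H, 1, β, γ, hH, one_ne_zero, hβ, hγ, by rw [one_smul, A1], A2, ?_⟩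
  rw [B3, hv', hv0]
  simp

lemma core_nonunique (F12 F13 F23 : Matrix (Fin 3) (Fin 3) ℝ)
    (P₁ P₂ P₃ : Matrix (Fin 3) (Fin 4) ℝ) (hP : IsSolution3 F12 F13 F23 P₁ P₂ P₃)
    (c1 c2 : Fin 4 → ℝ) (hc20 : c2 ≠ 0) (hc10 : c1 ≠ 0)
    (hc1 : P₁ *ᵥ c1 = 0) (hc2 : P₂ *ᵥ c2 = 0) (h31 : P₃ *ᵥ c1 ≠ 0)
    (h12 : ¬ ∃ c : ℝ, c1 = c • c2)
    (k : ℝ) (hpar : P₃ *ᵥ c1 = k • (P₃ *ᵥ c2)) :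
    ∃ Q₃, IsSolution3 F12 F13 F23 P₁ P₂ Q₃ ∧ ¬ ∃ (H : Matrix (Fin 4) (Fin 4) ℝ) (μ₁ μ₂ μ₃ : ℝ),
          H.det ≠ 0 ∧ μ₁ ≠ 0 ∧ μ₂ ≠ 0 ∧ μ₃ ≠ 0 ∧
          P₁ = μ₁ • (P₁ * H) ∧ P₂ = μ₂ • (P₂ * H) ∧ Q₃ = μ₃ • (P₃ * H) := by
  obtain ⟨p1, p2, p3, l12, l13, l23, hl12, hl13, hl23, e12, e13, e23⟩ := hP
  obtain ⟨v, hv0, hv⟩ : ∃ v : Fin 4 → ℝ, v ≠ 0 ∧ Matrix.of ![c1, c2, 0, 0] *ᵥ v = 0 := by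
    apply Matrix.exists_mulVec_eq_zero_iff.2
    exact Matrix.det_eq_zero_of_row_eq_zero 2 (by intro j; rfl)
  have h1 := congrFun hv 0
  have h2 := congrFun hv 1
  simp [Matrix.mulVec] at h1 h2
  have hdet : ∀ c : Fin 4 → ℝ, c ⬝ᵥ v = 0 → (1 + vecMulVec c v).det = 1 := by
    intro c hc
    rw [Matrix.vecMulVec_eq Unit, Matrix.det_one_add_replicateCol_mul_replicateRow, dotProduct_comm, hc,
      add_zero]
  have d1 := hdet c1 h1
  have d2 := hdet (k • c2) (by rw [smul_dotProduct, h2, smul_zero])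
  have eq1 : P₁ * (1 + vecMulVec c1 v) = P₁ := by
    rw [Matrix.mul_add, Matrix.mul_vecMulVec, hc1]; simp
  have eq2 : P₂ * (1 + vecMulVec (k • c2) v) = P₂ := by
    rw [Matrix.mul_add, Matrix.mul_vecMulVec, Matrix.mulVec_smul, hc2]; simp
  have eq3 : P₃ * (1 + vecMulVec c1 v) = P₃ * (1 + vecMulVec (k • c2) v) := by
    rw [Matrix.mul_add, Matrix.mul_vecMulVec, hpar, Matrix.mul_add, Matrix.mul_vecMulVec,
      Matrix.mulVec_smul]
  refine ⟨P₃ * (1 + vecMulVec c1 v), ⟨p1, p2, ?_, l12, l13, l23, hl12, hl13, hl23, e12, ?_, ?_⟩, ?_⟩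
  · unfold IsCamera at *
    rw [Matrix.rank_mul_eq_left_of_isUnit_det _ _ (by rw [d1]; exact isUnit_one), p3]
  · rw [e13]
    conv_rhs => rw [← eq1]
    rw [psi_mul, d1, one_smul]
  · rw [e23, eq3]
    conv_rhs => rw [← eq2]
    rw [psi_mul, d2, one_smul]
  · rintro ⟨H, μ₁, μ₂, μ₃, hH, hμ₁, hμ₂, hμ₃, A1, A2, A3⟩
    obtain ⟨s, hs⟩ := cam_outer P₁ p1 c1 hc10 hc1 (μ₁ • H - 1)
      (by rw [Matrix.mul_sub, Matrix.mul_smul, ← A1, Matrix.mul_one, sub_self])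
    obtain ⟨t, ht⟩ := cam_outer P₂ p2 c2 hc20 hc2 (μ₂ • H - 1)
      (by rw [Matrix.mul_sub, Matrix.mul_smul, ← A2, Matrix.mul_one, sub_self])
    have hs' : H = μ₁⁻¹ • (1 : Matrix (Fin 4) (Fin 4) ℝ) + vecMulVec c1 (μ₁⁻¹ • s) := by
      rw [Matrix.vecMulVec_smul, ← hs, smul_sub, smul_smul, inv_mul_cancel₀ hμ₁, one_smul]; abel
    have ht' : H = μ₂⁻¹ • (1 : Matrix (Fin 4) (Fin 4) ℝ) + vecMulVec c2 (μ₂⁻¹ • t) := by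
      rw [Matrix.vecMulVec_smul, ← ht, smul_sub, smul_smul, inv_mul_cancel₀ hμ₂, one_smul]; abel
    have hμ : μ₁⁻¹ - μ₂⁻¹ = 0 := by
      apply cam_rank P₃ p3 (P₃ *ᵥ c2) (P₃ *ᵥ c1) (μ₂⁻¹ • t) (μ₁⁻¹ • s)
      have := congrArg (P₃ * ·) (hs'.symm.trans ht')
      simp only [Matrix.mul_add, Matrix.mul_vecMulVec, Matrix.mul_smul, Matrix.mul_one] at this
      rw [sub_smul, sub_eq_sub_iff_add_eq_add, this, add_comm]
    have hst := hs'.symm.trans ht'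
    rw [sub_eq_zero.1 hμ, add_right_inj] at hst
    have hs0 := (outer_ind _ _ _ _ hc20 h12 hst).2
    rw [hs0] at ht'
    have hHs : H = μ₂⁻¹ • (1 : Matrix (Fin 4) (Fin 4) ℝ) := by rw [ht']; simp
    have A4 : (μ₃ * μ₂⁻¹ - 1) • P₃ = vecMulVec (P₃ *ᵥ c1) v := by
      rw [hHs, Matrix.mul_add, Matrix.mul_vecMulVec, Matrix.mul_smul, Matrix.mul_one, smul_smul] at A3
      rw [sub_smul, one_smul, ← A3]; abel
    have hz := cam_rank P₃ p3 (P₃ *ᵥ c1) 0 v 0 _ (by rw [A4]; simp)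
    rw [hz, zero_smul] at A4
    obtain ⟨i, hi⟩ := Function.ne_iff.1 h31
    apply hv0
    ext j
    have := congrFun (congrFun A4 i) j
    simp only [vecMulVec_apply, Matrix.zero_apply] at this
    exact (mul_eq_zero.1 this.symm).resolve_left hi

lemma par_trans {n : ℕ} {a b a' b' : Fin n → ℝ} (ha0 : a ≠ 0)
    (ha : ∃ k : ℝ, a = k • a') (hb : ∃ k : ℝ, b = k • b') (h : ∃ k : ℝ, a = k • b) :
    ∃ k : ℝ, a' = k • b' := by
  obtain ⟨x, hx⟩ := ha
  obtain ⟨y, hy⟩ := hb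
  obtain ⟨z, hz⟩ := h
  have hx0 : x ≠ 0 := by rintro rfl; simp at hx; exact ha0 hx
  refine ⟨x⁻¹ * z * y, ?_⟩
  rw [mul_smul, ← hy, mul_smul, ← hz, hx, smul_smul, inv_mul_cancel₀ hx0, one_smul]

lemma par_symm {n : ℕ} {a b : Fin n → ℝ} (ha0 : a ≠ 0) (h : ∃ k : ℝ, a = k • b) :
    ∃ k : ℝ, b = k • a := by
  obtain ⟨x, hx⟩ := h
  have hx0 : x ≠ 0 := by rintro rfl; simp at hx; exact ha0 hx
  exact ⟨x⁻¹, by rw [hx, smul_smul, inv_mul_cancel₀ hx0, one_smul]⟩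

/-- If, in the image of camera `A`, the images of two points are parallel, then so they are with
the roles of the centers exchanged. -/
lemma par_move (A B : Matrix (Fin 3) (Fin 4) ℝ) (hA : IsCamera A) (a b c : Fin 4 → ℝ)
    (ha0 : a ≠ 0) (ha : A *ᵥ a = 0) (hb : B *ᵥ b = 0)
    (h : ∃ k : ℝ, A *ᵥ c = k • (A *ᵥ b)) : ∃ k : ℝ, B *ᵥ c = k • (B *ᵥ a) := by
  obtain ⟨k, hk⟩ := h
  obtain ⟨m, hm⟩ := ker_par A (by unfold IsCamera at hA; omega) a (c - k • b) ha0 ha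
    (by rw [Matrix.mulVec_sub, Matrix.mulVec_smul, hk, sub_self])
  refine ⟨m, ?_⟩
  have := congrArg (B *ᵥ ·) hm
  simpa [Matrix.mulVec_sub, Matrix.mulVec_smul, hb] using this

lemma epi_facts (F : Matrix (Fin 3) (Fin 3) ℝ) (hF : F.rank = 2) (P Q : Matrix (Fin 3) (Fin 4) ℝ)
    (l : ℝ) (hl : l ≠ 0) (h : l • F = psi P Q) (c d : Fin 4 → ℝ) (hc0 : c ≠ 0) (hd0 : d ≠ 0)
    (hc : P *ᵥ c = 0) (hd : Q *ᵥ d = 0) (e f : Fin 3 → ℝ) 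
    (he : Fᵀ *ᵥ e = 0) (hf : F *ᵥ f = 0) :
    P *ᵥ d ≠ 0 ∧ Q *ᵥ c ≠ 0 ∧ (∃ k : ℝ, e = k • (P *ᵥ d)) ∧ (∃ k : ℝ, f = k • (Q *ᵥ c)) := by
  have hF0 : psi P Q ≠ 0 := by
    rw [← h]; intro h0
    rw [(smul_eq_zero.1 h0).resolve_left hl] at hF; simp at hF
  have n1 : P *ᵥ d ≠ 0 := fun h0 => hF0 (psi_zero _ _ d hd0 h0 hd)
  have n2 : Q *ᵥ c ≠ 0 := fun h0 => hF0 (psi_zero _ _ c hc0 hc h0)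
  have k1 : F *ᵥ (Q *ᵥ c) = 0 := by
    have := psi_epi P Q c hc0 hc
    rw [← h, Matrix.smul_mulVec] at this
    exact (smul_eq_zero.1 this).resolve_left hl
  have k2 : Fᵀ *ᵥ (P *ᵥ d) = 0 := by
    have := psi_epi' P Q d hd0 hd
    rw [← h, Matrix.transpose_smul, Matrix.smul_mulVec] at this
    exact (smul_eq_zero.1 this).resolve_left hl
  exact ⟨n1, n2, ker_par Fᵀ (by rw [Matrix.rank_transpose]; omega) _ _ n1 k2 he,
    ker_par F (by omega) _ _ n2 k1 hf⟩

theorem stmt2 (F12 F13 F23 : Matrix (Fin 3) (Fin 3) ℝ)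
    (hF12 : F12.rank = 2) (hF13 : F13.rank = 2) (hF23 : F23.rank = 2)
    (e12 e13 e21 e23 e31 e32 : Fin 3 → ℝ)
    (he12 : e12 ≠ 0) (hk12 : F12ᵀ *ᵥ e12 = 0)
    (he13 : e13 ≠ 0) (hk13 : F13ᵀ *ᵥ e13 = 0)
    (he21 : e21 ≠ 0) (hk21 : F12 *ᵥ e21 = 0)
    (he23 : e23 ≠ 0) (hk23 : F23ᵀ *ᵥ e23 = 0)
    (he31 : e31 ≠ 0) (hk31 : F13 *ᵥ e31 = 0)
    (he32 : e32 ≠ 0) (hk32 : F23 *ᵥ e32 = 0)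
    (hcompat : ∃ P₁ P₂ P₃, IsSolution3 F12 F13 F23 P₁ P₂ P₃) :
    (∀ P₁ P₂ P₃ Q₁ Q₂ Q₃ : Matrix (Fin 3) (Fin 4) ℝ,
        IsSolution3 F12 F13 F23 P₁ P₂ P₃ → IsSolution3 F12 F13 F23 Q₁ Q₂ Q₃ →
        ∃ (H : Matrix (Fin 4) (Fin 4) ℝ) (μ₁ μ₂ μ₃ : ℝ),
          H.det ≠ 0 ∧ μ₁ ≠ 0 ∧ μ₂ ≠ 0 ∧ μ₃ ≠ 0 ∧
          Q₁ = μ₁ • (P₁ * H) ∧ Q₂ = μ₂ • (P₂ * H) ∧ Q₃ = μ₃ • (P₃ * H)) ↔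
      ((¬ ∃ c : ℝ, e12 = c • e13) ∧ (¬ ∃ c : ℝ, e21 = c • e23) ∧
        (¬ ∃ c : ℝ, e31 = c • e32)) := by
  have centers : ∀ P₁ P₂ P₃ : Matrix (Fin 3) (Fin 4) ℝ, IsSolution3 F12 F13 F23 P₁ P₂ P₃ →
      ∃ c1 c2 c3 : Fin 4 → ℝ, (c1 ≠ 0 ∧ c2 ≠ 0 ∧ c3 ≠ 0) ∧
        (P₁ *ᵥ c1 = 0 ∧ P₂ *ᵥ c2 = 0 ∧ P₃ *ᵥ c3 = 0) ∧
        (P₁ *ᵥ c2 ≠ 0 ∧ P₂ *ᵥ c1 ≠ 0 ∧ (∃ k : ℝ, e12 = k • (P₁ *ᵥ c2)) ∧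
          (∃ k : ℝ, e21 = k • (P₂ *ᵥ c1))) ∧
        (P₁ *ᵥ c3 ≠ 0 ∧ P₃ *ᵥ c1 ≠ 0 ∧ (∃ k : ℝ, e13 = k • (P₁ *ᵥ c3)) ∧
          (∃ k : ℝ, e31 = k • (P₃ *ᵥ c1))) ∧
        (P₂ *ᵥ c3 ≠ 0 ∧ P₃ *ᵥ c2 ≠ 0 ∧ (∃ k : ℝ, e23 = k • (P₂ *ᵥ c3)) ∧
          (∃ k : ℝ, e32 = k • (P₃ *ᵥ c2))) := by
    rintro P₁ P₂ P₃ ⟨p1, p2, p3, l12, l13, l23, hl12, hl13, hl23, g12, g13, g23⟩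
    obtain ⟨c1, c10, hc1, -⟩ := ker_line P₁ (by unfold IsCamera at p1; omega)
    obtain ⟨c2, c20, hc2, -⟩ := ker_line P₂ (by unfold IsCamera at p2; omega)
    obtain ⟨c3, c30, hc3, -⟩ := ker_line P₃ (by unfold IsCamera at p3; omega)
    exact ⟨c1, c2, c3, ⟨c10, c20, c30⟩, ⟨hc1, hc2, hc3⟩,
      epi_facts F12 hF12 P₁ P₂ l12 hl12 g12 c1 c2 c10 c20 hc1 hc2 _ _ hk12 hk21,
      epi_facts F13 hF13 P₁ P₃ l13 hl13 g13 c1 c3 c10 c30 hc1 hc3 _ _ hk13 hk31,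
      epi_facts F23 hF23 P₂ P₃ l23 hl23 g23 c2 c3 c20 c30 hc2 hc3 _ _ hk23 hk32⟩
  constructor
  · intro huniq
    obtain ⟨P₁, P₂, P₃, hP⟩ := hcompat
    obtain ⟨c1, c2, c3, ⟨c10, c20, c30⟩, ⟨hc1, hc2, hc3⟩, ⟨n12, n21, E12, E21⟩,
      ⟨n13, n31, E13, E31⟩, ⟨n23, n32, E23, E32⟩⟩ := centers P₁ P₂ P₃ hP
    have hnot : ¬ ∃ k : ℝ, P₃ *ᵥ c1 = k • (P₃ *ᵥ c2) := by
      rintro ⟨k, hk⟩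
      obtain ⟨Q₃, hQ, hne⟩ := core_nonunique F12 F13 F23 P₁ P₂ P₃ hP c1 c2 c20 c10 hc1 hc2 n31
        (by
          rintro ⟨c, rfl⟩
          apply n21
          rw [Matrix.mulVec_smul, hc2, smul_zero]) k hk
      exact hne (huniq _ _ _ _ _ _ hP hQ)
    refine ⟨fun h => hnot ?_, fun h => hnot ?_, fun h => hnot ?_⟩
    · exact par_symm n32 (par_move P₁ P₃ hP.1 c1 c3 c2 c10 hc1 hc3 (par_trans he12 E12 E13 h))
    · exact par_move P₂ P₃ hP.2.1 c2 c3 c1 c20 hc2 hc3 (par_trans he21 E21 E23 h)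
    · exact par_trans he31 E31 E32 h
  · rintro ⟨-, -, h3⟩ P₁ P₂ P₃ Q₁ Q₂ Q₃ hP hQ
    obtain ⟨c1, c2, c3, ⟨c10, c20, c30⟩, ⟨hc1, hc2, hc3⟩, ⟨n12, n21, E12, E21⟩,
      ⟨n13, n31, E13, E31⟩, ⟨n23, n32, E23, E32⟩⟩ := centers P₁ P₂ P₃ hP
    refine core_unique F12 F13 F23 hF12 hF13 hF23 P₁ P₂ P₃ Q₁ Q₂ Q₃ hP hQ c1 c2 c10 c20 hc1 hc2 n32 ?_
    intro h
    exact h3 (par_trans n31 (par_symm he31 E31) (par_symm he32 E32) h)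
end

section
/- Consider the six rank-2 matrices: F¹² with rows (0,0,0),(0,0,1),(0,1,0); F¹³ with rows (0,0,1),(0,0,0),(0,1,0); F¹⁴ with rows (0,0,1),(0,1,0),(0,0,0); F²³ with rows (0,0,1),(0,0,0),(1,0,0); F²⁴ with rows (0,0,1),(1,0,0),(0,0,0); F³⁴ with rows (0,1,0),(2,0,0),(0,0,0). Then every one of the four sub-triples {F^{ij},F^{ik},F^{jk}} (for 1 ≤ i < j < k ≤ 4) is compatible, but the full sextuple {F^{ij} : 1 ≤ i < j ≤ 4} is NOT compatible: there exist no cameras P₁, P₂, P₃, P₄ and nonzero scalars λ_{ij} with λ_{ij} F^{ij} = ψ(Pᵢ,Pⱼ) for all i < j. -/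
open Matrix

/-- A triple of matrices `{F¹², F¹³, F²³}` is compatible. -/
def Compat3 (F12 F13 F23 : Matrix (Fin 3) (Fin 3) ℝ) : Prop :=
  ∃ (P₁ P₂ P₃ : Matrix (Fin 3) (Fin 4) ℝ) (l12 l13 l23 : ℝ),
    IsCamera P₁ ∧ IsCamera P₂ ∧ IsCamera P₃ ∧
    l12 ≠ 0 ∧ l13 ≠ 0 ∧ l23 ≠ 0 ∧
    l12 • F12 = psi P₁ P₂ ∧ l13 • F13 = psi P₁ P₃ ∧ l23 • F23 = psi P₂ P₃


/-! ## Cameras seeing the coordinate points -/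

/-- Camera with centre `e₁` seeing the other coordinate points at the coordinate points. -/
def cam1 (a b c : ℝ) : Matrix (Fin 3) (Fin 4) ℝ := !![0, a, 0, 0; 0, 0, b, 0; 0, 0, 0, c]
/-- Camera with centre `e₂`. -/
def cam2 (a b c : ℝ) : Matrix (Fin 3) (Fin 4) ℝ := !![a, 0, 0, 0; 0, 0, b, 0; 0, 0, 0, c]
/-- Camera with centre `e₃`. -/
def cam3 (a b c : ℝ) : Matrix (Fin 3) (Fin 4) ℝ := !![a, 0, 0, 0; 0, b, 0, 0; 0, 0, 0, c]
/-- Camera with centre `e₄`. -/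
def cam4 (a b c : ℝ) : Matrix (Fin 3) (Fin 4) ℝ := !![a, 0, 0, 0; 0, b, 0, 0; 0, 0, c, 0]

lemma bigMat_eq (P Q : Matrix (Fin 3) (Fin 4) ℝ) (x y : Fin 3 → ℝ) :
    bigMat P Q x y =
      !![P 0 0, P 0 1, P 0 2, P 0 3, x 0, 0;
         P 1 0, P 1 1, P 1 2, P 1 3, x 1, 0;
         P 2 0, P 2 1, P 2 2, P 2 3, x 2, 0;
         Q 0 0, Q 0 1, Q 0 2, Q 0 3, 0, y 0;
         Q 1 0, Q 1 1, Q 1 2, Q 1 3, 0, y 1;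
         Q 2 0, Q 2 1, Q 2 2, Q 2 3, 0, y 2] := by
  ext i j
  fin_cases i <;> fin_cases j <;> rfl

lemma bigMat_congr_left (P Q : Matrix (Fin 3) (Fin 4) ℝ) (x z y : Fin 3 → ℝ) (i j : Fin 6)
    (hj : j ≠ 4) : bigMat P Q x y i j = bigMat P Q z y i j := by
  have : (j : ℕ) ≠ 4 := fun h => hj (Fin.ext h)
  simp [bigMat, this]

lemma bigMat_congr_right (P Q : Matrix (Fin 3) (Fin 4) ℝ) (x z y : Fin 3 → ℝ) (i j : Fin 6)
    (hj : j ≠ 5) : bigMat P Q x y i j = bigMat P Q x z i j := by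
  have h5 : (j : ℕ) ≠ 5 := fun h => hj (Fin.ext h)
  have := j.isLt
  by_cases h4 : (j : ℕ) < 4
  · simp [bigMat, h4]
  · have h : (j : ℕ) = 4 := by omega
    simp [bigMat, h]

lemma bigMat_col4 (P Q : Matrix (Fin 3) (Fin 4) ℝ) (x y : Fin 3 → ℝ) (i : Fin 6) :
    bigMat P Q x y i 4 = ![x 0, x 1, x 2, 0, 0, 0] i := by
  fin_cases i <;> rfl

lemma bigMat_col5 (P Q : Matrix (Fin 3) (Fin 4) ℝ) (x y : Fin 3 → ℝ) (i : Fin 6) :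
    bigMat P Q x y i 5 = ![0, 0, 0, y 0, y 1, y 2] i := by
  fin_cases i <;> rfl

lemma bigMat_det_left (P Q : Matrix (Fin 3) (Fin 4) ℝ) (x y : Fin 3 → ℝ) :
    (bigMat P Q x y).det = ∑ a, x a * (bigMat P Q (Pi.single a 1) y).det := by
  have h : ∀ (z : Fin 3 → ℝ), (bigMat P Q z y).det = ∑ i : Fin 6, (-1) ^ (i + 4 : ℕ) *
      ![z 0, z 1, z 2, 0, 0, 0] i *
      ((bigMat P Q 0 y).submatrix i.succAbove (Fin.succAbove 4)).det := by
    intro z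
    rw [Matrix.det_succ_column _ 4]
    refine Finset.sum_congr rfl fun i _ => ?_
    rw [bigMat_col4]
    congr 2
    ext k l
    exact bigMat_congr_left _ _ _ _ _ _ _ (Fin.succAbove_ne _ _)
  simp only [h]
  simp [Fin.sum_univ_succ]
  ring

lemma bigMat_det_right (P Q : Matrix (Fin 3) (Fin 4) ℝ) (x y : Fin 3 → ℝ) :
    (bigMat P Q x y).det = ∑ b, y b * (bigMat P Q x (Pi.single b 1)).det := by
  have h : ∀ (z : Fin 3 → ℝ), (bigMat P Q x z).det = ∑ i : Fin 6, (-1) ^ (i + 5 : ℕ) *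
      ![0, 0, 0, z 0, z 1, z 2] i *
      ((bigMat P Q x 0).submatrix i.succAbove (Fin.succAbove 5)).det := by
    intro z
    rw [Matrix.det_succ_column _ 5]
    refine Finset.sum_congr rfl fun i _ => ?_
    rw [bigMat_col5]
    congr 2
    ext k l
    exact bigMat_congr_right _ _ _ _ _ _ _ (Fin.succAbove_ne _ _)
  simp only [h]
  simp [Fin.sum_univ_succ]
  ring

lemma bigMat_sub5 (P Q : Matrix (Fin 3) (Fin 4) ℝ) (x y : Fin 3 → ℝ) (a b : Fin 3) :
    ((bigMat P Q x y).submatrix (Fin.succAbove (Fin.natAdd 3 b : Fin 6)) (Fin.succAbove 5)).submatrix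
      (Fin.succAbove (Fin.castAdd 2 a : Fin 5)) (Fin.succAbove 4) =
    Matrix.of ![P (a.succAbove 0), P (a.succAbove 1), Q (b.succAbove 0), Q (b.succAbove 1)] := by
  ext k l
  fin_cases a <;> fin_cases b <;> fin_cases k <;> fin_cases l <;> rfl

lemma psi_eq_det (P Q : Matrix (Fin 3) (Fin 4) ℝ) (a b : Fin 3) :
    psi P Q a b = (-1) ^ (a + b : ℕ) * (Matrix.of ![P (a.succAbove 0), P (a.succAbove 1),
      Q (b.succAbove 0), Q (b.succAbove 1)]).det := by
  rw [psi, Matrix.det_succ_column _ 5, Finset.sum_eq_single (Fin.natAdd 3 b : Fin 6),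
    Matrix.det_succ_column _ 4, Finset.sum_eq_single (Fin.castAdd 2 a : Fin 5), bigMat_sub5]
  · have h5 : bigMat P Q (Pi.single a 1) (Pi.single b 1) (Fin.natAdd 3 b : Fin 6) 5 = 1 := by
      rw [bigMat_col5]
      fin_cases b <;> simp
    have h4 : (bigMat P Q (Pi.single a 1) (Pi.single b 1)).submatrix
        (Fin.succAbove (Fin.natAdd 3 b : Fin 6)) (Fin.succAbove 5) (Fin.castAdd 2 a : Fin 5) 4 = 1 := by
      rw [Matrix.submatrix_apply, show Fin.succAbove (5 : Fin 6) (4 : Fin 5) = 4 from rfl, bigMat_col4]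
      fin_cases a <;> fin_cases b <;> simp [Fin.succAbove]
    rw [h5, h4, mul_one, mul_one, ← mul_assoc]
    congr 1
    fin_cases a <;> fin_cases b <;> norm_num
  · intro i _ hi
    rw [Matrix.submatrix_apply, show Fin.succAbove (5 : Fin 6) (4 : Fin 5) = 4 from rfl, bigMat_col4]
    fin_cases a <;> fin_cases b <;> fin_cases i <;> first | exact absurd rfl hi | simp [Fin.succAbove]
  · simp
  · intro i _ hi
    rw [bigMat_col5]
    fin_cases b <;> fin_cases i <;> first | exact absurd rfl hi | simp
  · simp

lemma psi_mul_s11 (C : Matrix (Fin 4) (Fin 4) ℝ) : ∃ D : ℝ, ∀ P Q : Matrix (Fin 3) (Fin 4) ℝ,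
    psi (P * C) (Q * C) = D • psi P Q := by
  refine ⟨C.det, fun P Q => ?_⟩
  ext a b
  have h : Matrix.of ![(P * C) (a.succAbove 0), (P * C) (a.succAbove 1),
      (Q * C) (b.succAbove 0), (Q * C) (b.succAbove 1)] =
      Matrix.of ![P (a.succAbove 0), P (a.succAbove 1), Q (b.succAbove 0), Q (b.succAbove 1)] * C := by
    ext k l
    fin_cases k <;> rfl
  rw [Matrix.smul_apply, smul_eq_mul, psi_eq_det, psi_eq_det, h, Matrix.det_mul]
  ring


lemma det_rows (u v w z : Fin 4 → ℝ) : (Matrix.of ![u, v, w, z]).det =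
    (u 0 * v 1 - u 1 * v 0) * (w 2 * z 3 - w 3 * z 2) - (u 0 * v 2 - u 2 * v 0) * (w 1 * z 3 - w 3 * z 1)
    + (u 0 * v 3 - u 3 * v 0) * (w 1 * z 2 - w 2 * z 1) + (u 1 * v 2 - u 2 * v 1) * (w 0 * z 3 - w 3 * z 0)
    - (u 1 * v 3 - u 3 * v 1) * (w 0 * z 2 - w 2 * z 0) + (u 2 * v 3 - u 3 * v 2) * (w 0 * z 1 - w 1 * z 0) := by
  simp [Matrix.det_succ_row_zero, Fin.sum_univ_succ, Fin.succAbove]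
  ring

lemma bigMat_det_zero (P Q : Matrix (Fin 3) (Fin 4) ℝ) (x y : Fin 3 → ℝ) (v : Fin 4 → ℝ)
    (hv : v ≠ 0) (s t : ℝ) (hP : P *ᵥ v = s • x) (hQ : Q *ᵥ v = t • y) :
    (bigMat P Q x y).det = 0 := by
  rw [← Matrix.exists_mulVec_eq_zero_iff]
  refine ⟨![v 0, v 1, v 2, v 3, -s, -t], ?_, ?_⟩
  · intro h
    apply hv
    ext i
    fin_cases i
    · exact congrFun h 0
    · exact congrFun h 1
    · exact congrFun h 2
    · exact congrFun h 3
  · have p0 := congrFun hP 0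
    have p1 := congrFun hP 1
    have p2 := congrFun hP 2
    have q0 := congrFun hQ 0
    have q1 := congrFun hQ 1
    have q2 := congrFun hQ 2
    simp [Matrix.mulVec, dotProduct, Fin.sum_univ_succ] at p0 p1 p2 q0 q1 q2
    rw [bigMat_eq]
    ext i
    fin_cases i <;> simp [Matrix.mulVec, dotProduct, Fin.sum_univ_succ] <;> linarith

/-- The image of the second centre is a left epipole. -/
lemma epipole_left (P Q : Matrix (Fin 3) (Fin 4) ℝ) (v : Fin 4 → ℝ) (hv : v ≠ 0)
    (hQ : Q *ᵥ v = 0) (b : Fin 3) : ∑ a, (P *ᵥ v) a * psi P Q a b = 0 := by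
  simp only [psi]
  rw [← bigMat_det_left]
  exact bigMat_det_zero P Q _ _ v hv 1 0 (by simp) (by simp [hQ])

/-- The image of the first centre is a right epipole. -/
lemma epipole_right (P Q : Matrix (Fin 3) (Fin 4) ℝ) (v : Fin 4 → ℝ) (hv : v ≠ 0)
    (hP : P *ᵥ v = 0) (a : Fin 3) : ∑ b, (Q *ᵥ v) b * psi P Q a b = 0 := by
  simp only [psi]
  rw [← bigMat_det_right]
  exact bigMat_det_zero P Q _ _ v hv 0 1 (by simp [hP]) (by simp)

lemma psi_zero_s11 (P Q : Matrix (Fin 3) (Fin 4) ℝ) (v : Fin 4 → ℝ) (hv : v ≠ 0)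
    (hP : P *ᵥ v = 0) (hQ : Q *ᵥ v = 0) (a b : Fin 3) : psi P Q a b = 0 :=
  bigMat_det_zero P Q _ _ v hv 0 0 (by simp [hP]) (by simp [hQ])

lemma exists_centre (P : Matrix (Fin 3) (Fin 4) ℝ) : ∃ v : Fin 4 → ℝ, v ≠ 0 ∧ P *ᵥ v = 0 := by
  have h : LinearMap.ker P.mulVecLin ≠ ⊥ := LinearMap.ker_ne_bot_of_finrank_lt (by simp)
  obtain ⟨v, hv, h0⟩ := Submodule.exists_mem_ne_zero_of_ne_bot h
  exact ⟨v, h0, by simpa using hv⟩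

lemma psi_cam12 (a b c d e f : ℝ) : psi (cam1 a b c) (cam2 d e f) =
    !![0, 0, 0; 0, 0, a * c * d * e; 0, -(a * b * d * f), 0] := by
  ext i j
  rw [psi_eq_det, det_rows]
  fin_cases i <;> fin_cases j <;> simp [cam1, cam2, Fin.succAbove] <;> ring

lemma psi_cam13 (a b c d e f : ℝ) : psi (cam1 a b c) (cam3 d e f) =
    !![0, 0, b * c * d * e; 0, 0, 0; 0, -(a * b * d * f), 0] := by
  ext i j
  rw [psi_eq_det, det_rows]
  fin_cases i <;> fin_cases j <;> simp [cam1, cam3, Fin.succAbove] <;> ring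

lemma psi_cam14 (a b c d e f : ℝ) : psi (cam1 a b c) (cam4 d e f) =
    !![0, 0, b * c * d * e; 0, -(a * c * d * f), 0; 0, 0, 0] := by
  ext i j
  rw [psi_eq_det, det_rows]
  fin_cases i <;> fin_cases j <;> simp [cam1, cam4, Fin.succAbove] <;> ring

lemma psi_cam23 (a b c d e f : ℝ) : psi (cam2 a b c) (cam3 d e f) =
    !![0, 0, b * c * d * e; 0, 0, 0; -(a * b * e * f), 0, 0] := by
  ext i j
  rw [psi_eq_det, det_rows]
  fin_cases i <;> fin_cases j <;> simp [cam2, cam3, Fin.succAbove] <;> ring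

lemma psi_cam24 (a b c d e f : ℝ) : psi (cam2 a b c) (cam4 d e f) =
    !![0, 0, b * c * d * e; -(a * c * e * f), 0, 0; 0, 0, 0] := by
  ext i j
  rw [psi_eq_det, det_rows]
  fin_cases i <;> fin_cases j <;> simp [cam2, cam4, Fin.succAbove] <;> ring

lemma psi_cam34 (a b c d e f : ℝ) : psi (cam3 a b c) (cam4 d e f) =
    !![0, b * c * d * f, 0; -(a * c * e * f), 0, 0; 0, 0, 0] := by
  ext i j
  rw [psi_eq_det, det_rows]
  fin_cases i <;> fin_cases j <;> simp [cam3, cam4, Fin.succAbove] <;> ring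

lemma isCamera_of_mul (P : Matrix (Fin 3) (Fin 4) ℝ) (N : Matrix (Fin 4) (Fin 3) ℝ)
    (h : P * N = 1) : IsCamera P := by
  have h1 := Matrix.rank_mul_le_left P N
  rw [h, Matrix.rank_one] at h1
  have h2 := Matrix.rank_le_height P
  simp at h1
  exact le_antisymm h2 h1

lemma rank_two (F : Matrix (Fin 3) (Fin 3) ℝ) (A Y : Matrix (Fin 3) (Fin 2) ℝ)
    (B X : Matrix (Fin 2) (Fin 3) ℝ) (h : F = A * B) (h' : X * F * Y = 1) : F.rank = 2 := by
  have h1 := (Matrix.rank_mul_le_left (X * F) Y).trans (Matrix.rank_mul_le_right X F)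
  rw [h', Matrix.rank_one] at h1
  have h2 := (h ▸ Matrix.rank_mul_le_left A B : F.rank ≤ A.rank).trans (Matrix.rank_le_width A)
  simp at h1
  exact le_antisymm h2 h1

lemma isCamera_cam1 (a b c : ℝ) (ha : a ≠ 0) (hb : b ≠ 0) (hc : c ≠ 0) :
    IsCamera (cam1 a b c) := by
  apply isCamera_of_mul _ !![0, 0, 0; a⁻¹, 0, 0; 0, b⁻¹, 0; 0, 0, c⁻¹]
  ext i j
  fin_cases i <;> fin_cases j <;> simp [cam1, Matrix.mul_apply, Fin.sum_univ_succ, ha, hb, hc]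

lemma isCamera_cam2 (a b c : ℝ) (ha : a ≠ 0) (hb : b ≠ 0) (hc : c ≠ 0) :
    IsCamera (cam2 a b c) := by
  apply isCamera_of_mul _ !![a⁻¹, 0, 0; 0, 0, 0; 0, b⁻¹, 0; 0, 0, c⁻¹]
  ext i j
  fin_cases i <;> fin_cases j <;> simp [cam2, Matrix.mul_apply, Fin.sum_univ_succ, ha, hb, hc]

lemma isCamera_cam3 (a b c : ℝ) (ha : a ≠ 0) (hb : b ≠ 0) (hc : c ≠ 0) :
    IsCamera (cam3 a b c) := by
  apply isCamera_of_mul _ !![a⁻¹, 0, 0; 0, b⁻¹, 0; 0, 0, 0; 0, 0, c⁻¹]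
  ext i j
  fin_cases i <;> fin_cases j <;> simp [cam3, Matrix.mul_apply, Fin.sum_univ_succ, ha, hb, hc]

lemma isCamera_cam4 (a b c : ℝ) (ha : a ≠ 0) (hb : b ≠ 0) (hc : c ≠ 0) :
    IsCamera (cam4 a b c) := by
  apply isCamera_of_mul _ !![a⁻¹, 0, 0; 0, b⁻¹, 0; 0, 0, c⁻¹; 0, 0, 0]
  ext i j
  fin_cases i <;> fin_cases j <;> simp [cam4, Matrix.mul_apply, Fin.sum_univ_succ, ha, hb, hc]

lemma exists_single (w : Fin 3 → ℝ) (a : Fin 3) (hw : w ≠ 0) (h : ∀ k, k ≠ a → w k = 0) :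
    ∃ s : ℝ, s ≠ 0 ∧ w = Pi.single a s := by
  have hs : w = Pi.single a (w a) := by
    ext k
    by_cases hk : k = a
    · subst hk; simp
    · simp [hk, h k hk]
  refine ⟨w a, fun h0 => hw ?_, hs⟩
  rw [hs, h0, Pi.single_zero]

lemma mul_of_cols (P : Matrix (Fin 3) (Fin 4) ℝ) (v1 v2 v3 v4 : Fin 4 → ℝ) :
    P * (Matrix.of ![v1, v2, v3, v4])ᵀ =
      (Matrix.of ![P *ᵥ v1, P *ᵥ v2, P *ᵥ v3, P *ᵥ v4])ᵀ := by
  ext i j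
  fin_cases j <;> rfl

set_option maxHeartbeats 4000000 in
/-- Example `ex:counterexample2`: six rank-2 matrices, every sub-triple
of which is compatible, but the full sextuple is not compatible. -/
theorem stmt11 :
    let F12 : Matrix (Fin 3) (Fin 3) ℝ := !![0, 0, 0; 0, 0, 1; 0, 1, 0]
    let F13 : Matrix (Fin 3) (Fin 3) ℝ := !![0, 0, 1; 0, 0, 0; 0, 1, 0]
    let F14 : Matrix (Fin 3) (Fin 3) ℝ := !![0, 0, 1; 0, 1, 0; 0, 0, 0]
    let F23 : Matrix (Fin 3) (Fin 3) ℝ := !![0, 0, 1; 0, 0, 0; 1, 0, 0]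
    let F24 : Matrix (Fin 3) (Fin 3) ℝ := !![0, 0, 1; 1, 0, 0; 0, 0, 0]
    let F34 : Matrix (Fin 3) (Fin 3) ℝ := !![0, 1, 0; 2, 0, 0; 0, 0, 0]
    F12.rank = 2 ∧ F13.rank = 2 ∧ F14.rank = 2 ∧
    F23.rank = 2 ∧ F24.rank = 2 ∧ F34.rank = 2 ∧
    Compat3 F12 F13 F23 ∧ Compat3 F12 F14 F24 ∧
    Compat3 F13 F14 F34 ∧ Compat3 F23 F24 F34 ∧
    ¬ ∃ (P₁ P₂ P₃ P₄ : Matrix (Fin 3) (Fin 4) ℝ)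
        (l12 l13 l14 l23 l24 l34 : ℝ),
        IsCamera P₁ ∧ IsCamera P₂ ∧ IsCamera P₃ ∧ IsCamera P₄ ∧
        l12 ≠ 0 ∧ l13 ≠ 0 ∧ l14 ≠ 0 ∧ l23 ≠ 0 ∧ l24 ≠ 0 ∧ l34 ≠ 0 ∧
        l12 • F12 = psi P₁ P₂ ∧ l13 • F13 = psi P₁ P₃ ∧ l14 • F14 = psi P₁ P₄ ∧
        l23 • F23 = psi P₂ P₃ ∧ l24 • F24 = psi P₂ P₄ ∧ l34 • F34 = psi P₃ P₄ := by
  intro F12 F13 F14 F23 F24 F34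
  refine ⟨?_, ?_, ?_, ?_, ?_, ?_, ?_, ?_, ?_, ?_, ?_⟩
  · apply rank_two F12 !![0, 0; 1, 0; 0, 1] !![0, 0; 0, 1; 1, 0] !![0, 0, 1; 0, 1, 0] !![0, 1, 0; 0, 0, 1]
    all_goals
      ext i j
      fin_cases i <;> fin_cases j <;> simp [F12, Matrix.mul_apply, Fin.sum_univ_succ]
  · apply rank_two F13 !![1, 0; 0, 0; 0, 1] !![0, 0; 0, 1; 1, 0] !![0, 0, 1; 0, 1, 0] !![1, 0, 0; 0, 0, 1]
    all_goals
      ext i j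
      fin_cases i <;> fin_cases j <;> simp [F13, Matrix.mul_apply, Fin.sum_univ_succ]
  · apply rank_two F14 !![1, 0; 0, 1; 0, 0] !![0, 0; 0, 1; 1, 0] !![0, 0, 1; 0, 1, 0] !![1, 0, 0; 0, 1, 0]
    all_goals
      ext i j
      fin_cases i <;> fin_cases j <;> simp [F14, Matrix.mul_apply, Fin.sum_univ_succ]
  · apply rank_two F23 !![1, 0; 0, 0; 0, 1] !![0, 1; 0, 0; 1, 0] !![0, 0, 1; 1, 0, 0] !![1, 0, 0; 0, 0, 1]
    all_goals
      ext i j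
      fin_cases i <;> fin_cases j <;> simp [F23, Matrix.mul_apply, Fin.sum_univ_succ]
  · apply rank_two F24 !![1, 0; 0, 1; 0, 0] !![0, 1; 0, 0; 1, 0] !![0, 0, 1; 1, 0, 0] !![1, 0, 0; 0, 1, 0]
    all_goals
      ext i j
      fin_cases i <;> fin_cases j <;> simp [F24, Matrix.mul_apply, Fin.sum_univ_succ]
  · apply rank_two F34 !![1, 0; 0, 1; 0, 0] !![0, 1 / 2; 1, 0; 0, 0] !![0, 1, 0; 2, 0, 0] !![1, 0, 0; 0, 1, 0]
    all_goals
      ext i j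
      fin_cases i <;> fin_cases j <;> simp [F34, Matrix.mul_apply, Fin.sum_univ_succ]
  · refine ⟨cam1 (1) (1) (1), cam2 (1) (1) (-1), cam3 (1) (-1) (1), 1, -1, 1,
      isCamera_cam1 _ _ _ (by norm_num) (by norm_num) (by norm_num), isCamera_cam2 _ _ _ (by norm_num) (by norm_num) (by norm_num), isCamera_cam3 _ _ _ (by norm_num) (by norm_num) (by norm_num),
      by norm_num, by norm_num, by norm_num, ?_, ?_, ?_⟩
    · rw [psi_cam12]
      ext i j
      fin_cases i <;> fin_cases j <;> norm_num [F12]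
    · rw [psi_cam13]
      ext i j
      fin_cases i <;> fin_cases j <;> norm_num [F13]
    · rw [psi_cam23]
      ext i j
      fin_cases i <;> fin_cases j <;> norm_num [F23]
  · refine ⟨cam1 (1) (1) (1), cam2 (1) (1) (-1), cam4 (1) (1) (-1), 1, 1, -1,
      isCamera_cam1 _ _ _ (by norm_num) (by norm_num) (by norm_num), isCamera_cam2 _ _ _ (by norm_num) (by norm_num) (by norm_num), isCamera_cam4 _ _ _ (by norm_num) (by norm_num) (by norm_num),
      by norm_num, by norm_num, by norm_num, ?_, ?_, ?_⟩
    · rw [psi_cam12]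
      ext i j
      fin_cases i <;> fin_cases j <;> norm_num [F12]
    · rw [psi_cam14]
      ext i j
      fin_cases i <;> fin_cases j <;> norm_num [F14]
    · rw [psi_cam24]
      ext i j
      fin_cases i <;> fin_cases j <;> norm_num [F24]
  · refine ⟨cam1 (1) (1) (1), cam3 (2) (1) (-1), cam4 (1) (-1) (1), 2, -1, -1,
      isCamera_cam1 _ _ _ (by norm_num) (by norm_num) (by norm_num), isCamera_cam3 _ _ _ (by norm_num) (by norm_num) (by norm_num), isCamera_cam4 _ _ _ (by norm_num) (by norm_num) (by norm_num),
      by norm_num, by norm_num, by norm_num, ?_, ?_, ?_⟩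
    · rw [psi_cam13]
      ext i j
      fin_cases i <;> fin_cases j <;> norm_num [F13]
    · rw [psi_cam14]
      ext i j
      fin_cases i <;> fin_cases j <;> norm_num [F14]
    · rw [psi_cam34]
      ext i j
      fin_cases i <;> fin_cases j <;> norm_num [F34]
  · refine ⟨cam2 (1) (1) (1), cam3 (1) (1) (-1), cam4 (-1) (2) (1), 1, -2, 1,
      isCamera_cam2 _ _ _ (by norm_num) (by norm_num) (by norm_num), isCamera_cam3 _ _ _ (by norm_num) (by norm_num) (by norm_num), isCamera_cam4 _ _ _ (by norm_num) (by norm_num) (by norm_num),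
      by norm_num, by norm_num, by norm_num, ?_, ?_, ?_⟩
    · rw [psi_cam23]
      ext i j
      fin_cases i <;> fin_cases j <;> norm_num [F23]
    · rw [psi_cam24]
      ext i j
      fin_cases i <;> fin_cases j <;> norm_num [F24]
    · rw [psi_cam34]
      ext i j
      fin_cases i <;> fin_cases j <;> norm_num [F34]
  · rintro ⟨P1, P2, P3, P4, l12, l13, l14, l23, l24, l34, -, -, -, -, n12, n13, n14, n23, n24, n34,
      h12, h13, h14, h23, h24, h34⟩
    obtain ⟨v1, hv1, z1⟩ := exists_centre P1
    obtain ⟨v2, hv2, z2⟩ := exists_centre P2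
    obtain ⟨v3, hv3, z3⟩ := exists_centre P3
    obtain ⟨v4, hv4, z4⟩ := exists_centre P4
    have e12 := epipole_left P1 P2 v2 hv2 z2
    have w12 : P1 *ᵥ v2 ≠ 0 := by
      intro h
      have := psi_zero_s11 P1 P2 v2 hv2 h z2 1 2
      rw [← h12] at this
      simp [F12, n12] at this
    rw [← h12] at e12
    have g12 : ∃ s : ℝ, s ≠ 0 ∧ P1 *ᵥ v2 = Pi.single 0 s := by
      have t0 := e12 0
      have t1 := e12 1
      have t2 := e12 2
      simp [F12, Fin.sum_univ_succ, n12] at t0 t1 t2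
      exact exists_single _ 0 w12 (by intro k hk; fin_cases k <;> first | exact absurd rfl hk | assumption)
    obtain ⟨s12, m12, k12⟩ := g12
    have e13 := epipole_left P1 P3 v3 hv3 z3
    have w13 : P1 *ᵥ v3 ≠ 0 := by
      intro h
      have := psi_zero_s11 P1 P3 v3 hv3 h z3 0 2
      rw [← h13] at this
      simp [F13, n13] at this
    rw [← h13] at e13
    have g13 : ∃ s : ℝ, s ≠ 0 ∧ P1 *ᵥ v3 = Pi.single 1 s := by
      have t0 := e13 0
      have t1 := e13 1
      have t2 := e13 2
      simp [F13, Fin.sum_univ_succ, n13] at t0 t1 t2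
      exact exists_single _ 1 w13 (by intro k hk; fin_cases k <;> first | exact absurd rfl hk | assumption)
    obtain ⟨s13, m13, k13⟩ := g13
    have e14 := epipole_left P1 P4 v4 hv4 z4
    have w14 : P1 *ᵥ v4 ≠ 0 := by
      intro h
      have := psi_zero_s11 P1 P4 v4 hv4 h z4 0 2
      rw [← h14] at this
      simp [F14, n14] at this
    rw [← h14] at e14
    have g14 : ∃ s : ℝ, s ≠ 0 ∧ P1 *ᵥ v4 = Pi.single 2 s := by
      have t0 := e14 0
      have t1 := e14 1
      have t2 := e14 2
      simp [F14, Fin.sum_univ_succ, n14] at t0 t1 t2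
      exact exists_single _ 2 w14 (by intro k hk; fin_cases k <;> first | exact absurd rfl hk | assumption)
    obtain ⟨s14, m14, k14⟩ := g14
    have e21 := epipole_right P1 P2 v1 hv1 z1
    have w21 : P2 *ᵥ v1 ≠ 0 := by
      intro h
      have := psi_zero_s11 P1 P2 v1 hv1 z1 h 1 2
      rw [← h12] at this
      simp [F12, n12] at this
    rw [← h12] at e21
    have g21 : ∃ s : ℝ, s ≠ 0 ∧ P2 *ᵥ v1 = Pi.single 0 s := by
      have t0 := e21 0
      have t1 := e21 1
      have t2 := e21 2
      simp [F12, Fin.sum_univ_succ, n12] at t0 t1 t2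
      exact exists_single _ 0 w21 (by intro k hk; fin_cases k <;> first | exact absurd rfl hk | assumption)
    obtain ⟨s21, m21, k21⟩ := g21
    have e23 := epipole_left P2 P3 v3 hv3 z3
    have w23 : P2 *ᵥ v3 ≠ 0 := by
      intro h
      have := psi_zero_s11 P2 P3 v3 hv3 h z3 0 2
      rw [← h23] at this
      simp [F23, n23] at this
    rw [← h23] at e23
    have g23 : ∃ s : ℝ, s ≠ 0 ∧ P2 *ᵥ v3 = Pi.single 1 s := by
      have t0 := e23 0
      have t1 := e23 1
      have t2 := e23 2
      simp [F23, Fin.sum_univ_succ, n23] at t0 t1 t2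
      exact exists_single _ 1 w23 (by intro k hk; fin_cases k <;> first | exact absurd rfl hk | assumption)
    obtain ⟨s23, m23, k23⟩ := g23
    have e24 := epipole_left P2 P4 v4 hv4 z4
    have w24 : P2 *ᵥ v4 ≠ 0 := by
      intro h
      have := psi_zero_s11 P2 P4 v4 hv4 h z4 0 2
      rw [← h24] at this
      simp [F24, n24] at this
    rw [← h24] at e24
    have g24 : ∃ s : ℝ, s ≠ 0 ∧ P2 *ᵥ v4 = Pi.single 2 s := by
      have t0 := e24 0
      have t1 := e24 1
      have t2 := e24 2
      simp [F24, Fin.sum_univ_succ, n24] at t0 t1 t2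
      exact exists_single _ 2 w24 (by intro k hk; fin_cases k <;> first | exact absurd rfl hk | assumption)
    obtain ⟨s24, m24, k24⟩ := g24
    have e31 := epipole_right P1 P3 v1 hv1 z1
    have w31 : P3 *ᵥ v1 ≠ 0 := by
      intro h
      have := psi_zero_s11 P1 P3 v1 hv1 z1 h 0 2
      rw [← h13] at this
      simp [F13, n13] at this
    rw [← h13] at e31
    have g31 : ∃ s : ℝ, s ≠ 0 ∧ P3 *ᵥ v1 = Pi.single 0 s := by
      have t0 := e31 0
      have t1 := e31 1
      have t2 := e31 2
      simp [F13, Fin.sum_univ_succ, n13] at t0 t1 t2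
      exact exists_single _ 0 w31 (by intro k hk; fin_cases k <;> first | exact absurd rfl hk | assumption)
    obtain ⟨s31, m31, k31⟩ := g31
    have e32 := epipole_right P2 P3 v2 hv2 z2
    have w32 : P3 *ᵥ v2 ≠ 0 := by
      intro h
      have := psi_zero_s11 P2 P3 v2 hv2 z2 h 0 2
      rw [← h23] at this
      simp [F23, n23] at this
    rw [← h23] at e32
    have g32 : ∃ s : ℝ, s ≠ 0 ∧ P3 *ᵥ v2 = Pi.single 1 s := by
      have t0 := e32 0
      have t1 := e32 1
      have t2 := e32 2
      simp [F23, Fin.sum_univ_succ, n23] at t0 t1 t2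
      exact exists_single _ 1 w32 (by intro k hk; fin_cases k <;> first | exact absurd rfl hk | assumption)
    obtain ⟨s32, m32, k32⟩ := g32
    have e34 := epipole_left P3 P4 v4 hv4 z4
    have w34 : P3 *ᵥ v4 ≠ 0 := by
      intro h
      have := psi_zero_s11 P3 P4 v4 hv4 h z4 0 1
      rw [← h34] at this
      simp [F34, n34] at this
    rw [← h34] at e34
    have g34 : ∃ s : ℝ, s ≠ 0 ∧ P3 *ᵥ v4 = Pi.single 2 s := by
      have t0 := e34 0
      have t1 := e34 1
      have t2 := e34 2
      simp [F34, Fin.sum_univ_succ, n34] at t0 t1 t2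
      exact exists_single _ 2 w34 (by intro k hk; fin_cases k <;> first | exact absurd rfl hk | assumption)
    obtain ⟨s34, m34, k34⟩ := g34
    have e41 := epipole_right P1 P4 v1 hv1 z1
    have w41 : P4 *ᵥ v1 ≠ 0 := by
      intro h
      have := psi_zero_s11 P1 P4 v1 hv1 z1 h 0 2
      rw [← h14] at this
      simp [F14, n14] at this
    rw [← h14] at e41
    have g41 : ∃ s : ℝ, s ≠ 0 ∧ P4 *ᵥ v1 = Pi.single 0 s := by
      have t0 := e41 0
      have t1 := e41 1
      have t2 := e41 2
      simp [F14, Fin.sum_univ_succ, n14] at t0 t1 t2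
      exact exists_single _ 0 w41 (by intro k hk; fin_cases k <;> first | exact absurd rfl hk | assumption)
    obtain ⟨s41, m41, k41⟩ := g41
    have e42 := epipole_right P2 P4 v2 hv2 z2
    have w42 : P4 *ᵥ v2 ≠ 0 := by
      intro h
      have := psi_zero_s11 P2 P4 v2 hv2 z2 h 0 2
      rw [← h24] at this
      simp [F24, n24] at this
    rw [← h24] at e42
    have g42 : ∃ s : ℝ, s ≠ 0 ∧ P4 *ᵥ v2 = Pi.single 1 s := by
      have t0 := e42 0
      have t1 := e42 1
      have t2 := e42 2
      simp [F24, Fin.sum_univ_succ, n24] at t0 t1 t2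
      exact exists_single _ 1 w42 (by intro k hk; fin_cases k <;> first | exact absurd rfl hk | assumption)
    obtain ⟨s42, m42, k42⟩ := g42
    have e43 := epipole_right P3 P4 v3 hv3 z3
    have w43 : P4 *ᵥ v3 ≠ 0 := by
      intro h
      have := psi_zero_s11 P3 P4 v3 hv3 z3 h 0 1
      rw [← h34] at this
      simp [F34, n34] at this
    rw [← h34] at e43
    have g43 : ∃ s : ℝ, s ≠ 0 ∧ P4 *ᵥ v3 = Pi.single 2 s := by
      have t0 := e43 0
      have t1 := e43 1
      have t2 := e43 2
      simp [F34, Fin.sum_univ_succ, n34] at t0 t1 t2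
      exact exists_single _ 2 w43 (by intro k hk; fin_cases k <;> first | exact absurd rfl hk | assumption)
    obtain ⟨s43, m43, k43⟩ := g43
    obtain ⟨D, hD⟩ := psi_mul_s11 (Matrix.of ![v1, v2, v3, v4])ᵀ
    have q1 : P1 * (Matrix.of ![v1, v2, v3, v4])ᵀ = cam1 s12 s13 s14 := by
      rw [mul_of_cols, z1, k12, k13, k14]
      ext i j
      fin_cases i <;> fin_cases j <;> simp [cam1]
    have q2 : P2 * (Matrix.of ![v1, v2, v3, v4])ᵀ = cam2 s21 s23 s24 := by
      rw [mul_of_cols, k21, z2, k23, k24]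
      ext i j
      fin_cases i <;> fin_cases j <;> simp [cam2]
    have q3 : P3 * (Matrix.of ![v1, v2, v3, v4])ᵀ = cam3 s31 s32 s34 := by
      rw [mul_of_cols, k31, k32, z3, k34]
      ext i j
      fin_cases i <;> fin_cases j <;> simp [cam3]
    have q4 : P4 * (Matrix.of ![v1, v2, v3, v4])ᵀ = cam4 s41 s42 s43 := by
      rw [mul_of_cols, k41, k42, k43, z4]
      ext i j
      fin_cases i <;> fin_cases j <;> simp [cam4]
    have f12 := hD P1 P2
    rw [q1, q2, psi_cam12, ← h12] at f12
    have x12 := congrFun (congrFun f12 1) 2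
    have y12 := congrFun (congrFun f12 2) 1
    simp [F12] at x12 y12
    have f13 := hD P1 P3
    rw [q1, q3, psi_cam13, ← h13] at f13
    have x13 := congrFun (congrFun f13 0) 2
    have y13 := congrFun (congrFun f13 2) 1
    simp [F13] at x13 y13
    have f14 := hD P1 P4
    rw [q1, q4, psi_cam14, ← h14] at f14
    have x14 := congrFun (congrFun f14 0) 2
    have y14 := congrFun (congrFun f14 1) 1
    simp [F14] at x14 y14
    have f23 := hD P2 P3
    rw [q2, q3, psi_cam23, ← h23] at f23
    have x23 := congrFun (congrFun f23 0) 2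
    have y23 := congrFun (congrFun f23 2) 0
    simp [F23] at x23 y23
    have f24 := hD P2 P4
    rw [q2, q4, psi_cam24, ← h24] at f24
    have x24 := congrFun (congrFun f24 0) 2
    have y24 := congrFun (congrFun f24 1) 0
    simp [F24] at x24 y24
    have f34 := hD P3 P4
    rw [q3, q4, psi_cam34, ← h34] at f34
    have x34 := congrFun (congrFun f34 0) 1
    have y34 := congrFun (congrFun f34 1) 0
    simp [F34] at x34 y34
    clear hD f12 f13 f14 f23 f24 f34
    -- ratios
    have r12 : s14 * s23 = -(s13 * s24) := by
      apply mul_left_cancel₀ (mul_ne_zero m12 m21)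
      linear_combination x12 - y12
    have r13 : s14 * s32 = -(s12 * s34) := by
      apply mul_left_cancel₀ (mul_ne_zero m13 m31)
      linear_combination x13 - y13
    have r14 : s13 * s42 = -(s12 * s43) := by
      apply mul_left_cancel₀ (mul_ne_zero m14 m41)
      linear_combination x14 - y14
    have r23 : s24 * s31 = -(s21 * s34) := by
      apply mul_left_cancel₀ (mul_ne_zero m23 m32)
      linear_combination x23 - y23
    have r24 : s23 * s41 = -(s21 * s43) := by
      apply mul_left_cancel₀ (mul_ne_zero m24 m42)
      linear_combination x24 - y24
    have r34 : s31 * s42 = -2 * (s32 * s41) := by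
      apply mul_left_cancel₀ (mul_ne_zero m34 m43)
      linear_combination 2 * x34 - y34
    -- both `s31 * s42` and `-(s32 * s41)` are `s12 * s21 * s34 * s43 / (s13 * s24)`
    have u1 : (s13 * s24) * (s31 * s42) = s12 * s21 * s34 * s43 := by
      linear_combination s24 * s31 * r14 - s12 * s43 * r23
    have u2 : (s14 * s23) * (s32 * s41) = s12 * s21 * s34 * s43 := by
      linear_combination s23 * s41 * r13 - s12 * s34 * r24
    have u3 : (s13 * s24) * (s32 * s41) = 0 := by
      rw [r12] at u2
      rw [r34] at u1
      linear_combination u2 - u1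
    exact mul_ne_zero (mul_ne_zero m13 m24) (mul_ne_zero m32 m41) u3
end

section
/- Let {F^{ij} : 1 ≤ i < j ≤ 4} be six fundamental matrices with chosen epipoles e_j^i, and suppose that in each image i the three epipoles e_i^j, e_i^k, e_i^l (where {j,k,l} = {1,2,3,4}∖{i}) are linearly independent in ℝ³. Then {F^{ij}} is compatible if and only if (e_i^k)ᵀ F^{ij} e_j^k = 0 for all pairwise distinct i, j, k ∈ {1,2,3,4}, and the epipolar numbers 𝐞_{sijt} := (e_i^s)ᵀ F^{ij} e_j^t satisfy 𝐞₄₁₂₃ 𝐞₂₁₃₄ 𝐞₃₁₄₂ 𝐞₄₂₃₁ 𝐞₁₂₄₃ 𝐞₂₃₄₁ = 𝐞₃₁₂₄ 𝐞₄₁₃₂ 𝐞₂₁₄₃ 𝐞₁₂₃₄ 𝐞₃₂₄₁ 𝐞₁₃₄₂. -/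
open Matrix

/-- The six fundamental matrices `{F i j : i < j}` (on four views) are compatible. -/
def Compat4 (F : Fin 4 → Fin 4 → Matrix (Fin 3) (Fin 3) ℝ) : Prop :=
  ∃ (P : Fin 4 → Matrix (Fin 3) (Fin 4) ℝ) (lam : Fin 4 → Fin 4 → ℝ),
    (∀ i, IsCamera (P i)) ∧
      ∀ i j, i < j → lam i j ≠ 0 ∧ lam i j • F i j = psi (P i) (P j)

set_option linter.unusedSimpArgs false


lemma bigMat_mulVec (P Q : Matrix (Fin 3) (Fin 4) ℝ) (x y : Fin 3 → ℝ) (w : Fin 6 → ℝ) :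
    bigMat P Q x y *ᵥ w = 0 ↔
      P *ᵥ ![w 0, w 1, w 2, w 3] + w 4 • x = 0 ∧ Q *ᵥ ![w 0, w 1, w 2, w 3] + w 5 • y = 0 := by
  simp only [funext_iff, Fin.forall_fin_succ, bigMat, Matrix.mulVec, dotProduct, Fin.sum_univ_succ]
  simp [Fin.succ, Matrix.mulVec, dotProduct, Fin.sum_univ_succ]
  ring_nf
  tauto

lemma det_bigMat_eq_zero (P Q : Matrix (Fin 3) (Fin 4) ℝ) (x y : Fin 3 → ℝ) :
    (bigMat P Q x y).det = 0 ↔ ∃ (v : Fin 4 → ℝ) (a b : ℝ), (v ≠ 0 ∨ a ≠ 0 ∨ b ≠ 0) ∧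
      P *ᵥ v + a • x = 0 ∧ Q *ᵥ v + b • y = 0 := by
  rw [← Matrix.exists_mulVec_eq_zero_iff]
  constructor
  · rintro ⟨w, hw, h⟩
    rw [bigMat_mulVec] at h
    refine ⟨_, _, _, ?_, h⟩
    by_contra! hc
    apply hw
    obtain ⟨h1, h2, h3⟩ := hc
    simp [funext_iff, Fin.forall_fin_succ] at h1
    funext k
    fin_cases k <;> simp_all
  · rintro ⟨v, a, b, hne, h⟩
    have hv : ![v 0, v 1, v 2, v 3] = v := by
      funext k; fin_cases k <;> rfl
    refine ⟨![v 0, v 1, v 2, v 3, a, b], ?_, ?_⟩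
    · intro hc
      simp [funext_iff, Fin.forall_fin_succ] at hc
      rcases hne with h | h | h
      · apply h; funext k; fin_cases k <;> simp_all
      · simp_all
      · simp_all
    · rw [bigMat_mulVec]
      simpa [hv] using h

def embLo (y : Fin 3 → ℝ) : Fin 6 → ℝ := ![0, 0, 0, y 0, y 1, y 2]
def embHi (x : Fin 3 → ℝ) : Fin 6 → ℝ := ![x 0, x 1, x 2, 0, 0, 0]

lemma bigMat_y (P Q : Matrix (Fin 3) (Fin 4) ℝ) (x y : Fin 3 → ℝ) :
    (bigMat P Q x y).det = cramer (bigMat P Q x 0) (embLo y) 5 := by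
  rw [cramer_apply]
  congr 1
  funext a b
  fin_cases a <;> fin_cases b <;> simp [bigMat, Matrix.updateCol_apply, embLo] 

lemma bigMat_x (P Q : Matrix (Fin 3) (Fin 4) ℝ) (x y : Fin 3 → ℝ) :
    (bigMat P Q x y).det = cramer (bigMat P Q 0 y) (embHi x) 4 := by
  rw [cramer_apply]
  congr 1
  funext a b
  fin_cases a <;> fin_cases b <;> simp [bigMat, Matrix.updateCol_apply, embHi] 

lemma psi_spec (P Q : Matrix (Fin 3) (Fin 4) ℝ) (x y : Fin 3 → ℝ) :
    x ⬝ᵥ (psi P Q *ᵥ y) = (bigMat P Q x y).det := by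
  have hy : ∀ x, (bigMat P Q x y).det = ∑ b, y b * (bigMat P Q x (Pi.single b 1)).det := by
    intro x
    simp_rw [bigMat_y P Q x]
    have : embLo y = ∑ b, y b • embLo (Pi.single b 1) := by
      funext k; fin_cases k <;> simp [embLo, Fin.sum_univ_succ]
    rw [this, map_sum]
    simp
  have hx : ∀ y, (bigMat P Q x y).det = ∑ a, x a * (bigMat P Q (Pi.single a 1) y).det := by
    intro y
    simp_rw [fun x => bigMat_x P Q x y]
    have : embHi x = ∑ b, x b • embHi (Pi.single b 1) := by
      funext k; fin_cases k <;> simp [embHi, Fin.sum_univ_succ]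
    rw [this, map_sum]
    simp
  rw [hx]
  simp only [dotProduct, Matrix.mulVec]
  refine Finset.sum_congr rfl fun a _ => ?_
  rw [hy]
  congr 1
  refine Finset.sum_congr rfl fun b _ => ?_
  rw [mul_comm]; rfl

lemma psi_alt (P Q : Matrix (Fin 3) (Fin 4) ℝ) (c : Fin 4 → ℝ) :
    (P *ᵥ c) ⬝ᵥ (psi P Q *ᵥ (Q *ᵥ c)) = 0 := by
  rw [psi_spec, det_bigMat_eq_zero]
  exact ⟨c, -1, -1, by simp, by simp, by simp⟩

lemma eq_of_dot {m : ℕ} {A B : Matrix (Fin m) (Fin m) ℝ}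
    (h : ∀ x y, x ⬝ᵥ (A *ᵥ y) = x ⬝ᵥ (B *ᵥ y)) : A = B := by
  funext a b
  simpa using h (Pi.single a 1) (Pi.single b 1)

lemma psi_eq_zero (P Q : Matrix (Fin 3) (Fin 4) ℝ) (c : Fin 4 → ℝ) (hc : c ≠ 0)
    (h1 : P *ᵥ c = 0) (h2 : Q *ᵥ c = 0) : psi P Q = 0 := by
  apply eq_of_dot
  intro x y
  rw [psi_spec, (det_bigMat_eq_zero P Q x y).2 ⟨c, 0, 0, by simp [hc], by simp [h1], by simp [h2]⟩]
  simp

lemma surj_of_rank {P : Matrix (Fin 3) (Fin 4) ℝ} (h : P.rank = 3) (x : Fin 3 → ℝ) :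
    ∃ v, P *ᵥ v = x := by
  have : LinearMap.range P.mulVecLin = ⊤ := by
    apply Submodule.eq_top_of_finrank_eq
    rw [← Matrix.rank]
    simp [h]
  obtain ⟨v, hv⟩ := LinearMap.range_eq_top.1 this x
  exact ⟨v, hv⟩

lemma exists_center (P : Matrix (Fin 3) (Fin 4) ℝ) : ∃ c, c ≠ 0 ∧ P *ᵥ c = 0 := by
  have : LinearMap.ker P.mulVecLin ≠ ⊥ := LinearMap.ker_ne_bot_of_finrank_lt (by simp)
  obtain ⟨c, hc, h⟩ := Submodule.exists_mem_ne_zero_of_ne_bot this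
  exact ⟨c, h, by simpa using hc⟩

lemma ker_rank2 {F : Matrix (Fin 3) (Fin 3) ℝ} (h : F.rank = 2) {e w : Fin 3 → ℝ}
    (he : e ≠ 0) (h1 : F *ᵥ e = 0) (h2 : F *ᵥ w = 0) : ∃ c : ℝ, w = c • e := by
  have hk : Module.finrank ℝ (LinearMap.ker F.mulVecLin) = 1 := by
    have := LinearMap.finrank_range_add_finrank_ker F.mulVecLin
    rw [← Matrix.rank, h] at this
    simp at this
    omega
  have := (finrank_eq_one_iff_of_nonzero' (⟨e, by simpa using h1⟩ : LinearMap.ker F.mulVecLin)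
    (by simpa using he)).1 hk ⟨w, by simpa using h2⟩
  obtain ⟨c, hc⟩ := this
  exact ⟨c, by simpa using (congrArg Subtype.val hc).symm⟩

lemma dot_transpose (F : Matrix (Fin 3) (Fin 3) ℝ) (x y : Fin 3 → ℝ) :
    x ⬝ᵥ (Fᵀ *ᵥ y) = y ⬝ᵥ (F *ᵥ x) := by
  rw [Matrix.mulVec_transpose, dotProduct_comm, Matrix.dotProduct_mulVec]

lemma alt_skew {P Q : Matrix (Fin 3) (Fin 4) ℝ} {F : Matrix (Fin 3) (Fin 3) ℝ}
    (h : ∀ c, (P *ᵥ c) ⬝ᵥ (F *ᵥ (Q *ᵥ c)) = 0) (c d : Fin 4 → ℝ) :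
    (P *ᵥ c) ⬝ᵥ (F *ᵥ (Q *ᵥ d)) = - ((P *ᵥ d) ⬝ᵥ (F *ᵥ (Q *ᵥ c))) := by
  have := h (c + d)
  simp only [Matrix.mulVec_add, add_dotProduct, dotProduct_add, h] at this
  linarith

lemma indep_dot {a b c w : Fin 3 → ℝ} (h : LinearIndependent ℝ ![a, b, c])
    (ha : a ⬝ᵥ w = 0) (hb : b ⬝ᵥ w = 0) (hc : c ⬝ᵥ w = 0) : w = 0 := by
  have hu : IsUnit (Matrix.of ![a, b, c]) := Matrix.linearIndependent_rows_iff_isUnit.1 h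
  have : Function.Injective (Matrix.of ![a, b, c]).mulVec := Matrix.mulVec_injective_of_isUnit hu
  apply this
  funext k
  fin_cases k <;> simp [Matrix.mulVec, ha, hb, hc]

lemma pair_lemma {P Q : Matrix (Fin 3) (Fin 4) ℝ} {F : Matrix (Fin 3) (Fin 3) ℝ}
    (i j s t : Fin 4) (hcov : ∀ k, k = i ∨ k = j ∨ k = s ∨ k = t)
    (hij : i ≠ j) (his : i ≠ s) (hit : i ≠ t) (hjs : j ≠ s) (hjt : j ≠ t) (hst : s ≠ t)
    (hF : F ≠ 0) (hPr : P.rank = 3) (hQr : Q.rank = 3)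
    (hPi : P *ᵥ (Pi.single i 1) = 0) (hQj : Q *ᵥ (Pi.single j 1) = 0)
    (hP : ∀ v, P *ᵥ v = 0 → ∀ k, k ≠ i → v k = 0)
    (hQ : ∀ v, Q *ᵥ v = 0 → ∀ k, k ≠ j → v k = 0)
    (h : ∀ c, (P *ᵥ c) ⬝ᵥ (F *ᵥ (Q *ᵥ c)) = 0) :
    ∃ l : ℝ, l ≠ 0 ∧ l • F = psi P Q := by
  -- a bilinear form of this type is determined by one entry
  have key : ∀ G : Matrix (Fin 3) (Fin 3) ℝ, (∀ c, (P *ᵥ c) ⬝ᵥ (G *ᵥ (Q *ᵥ c)) = 0) →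
      (P *ᵥ (Pi.single s 1)) ⬝ᵥ (G *ᵥ (Q *ᵥ (Pi.single t 1))) = 0 → G = 0 := by
    intro G hG h0
    have hts : (P *ᵥ (Pi.single t 1)) ⬝ᵥ (G *ᵥ (Q *ᵥ (Pi.single s 1))) = 0 := by
      rw [alt_skew hG, h0, neg_zero]
    have hi1 : ∀ d, (P *ᵥ (Pi.single i 1)) ⬝ᵥ (G *ᵥ (Q *ᵥ d)) = 0 := by
      intro d; rw [hPi]; simp
    have hi2 : ∀ d, (P *ᵥ d) ⬝ᵥ (G *ᵥ (Q *ᵥ (Pi.single i 1))) = 0 := by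
      intro d; rw [alt_skew hG, hi1, neg_zero]
    have hj2 : ∀ d, (P *ᵥ d) ⬝ᵥ (G *ᵥ (Q *ᵥ (Pi.single j 1))) = 0 := by
      intro d; rw [hQj]; simp
    have hj1 : ∀ d, (P *ᵥ (Pi.single j 1)) ⬝ᵥ (G *ᵥ (Q *ᵥ d)) = 0 := by
      intro d; rw [alt_skew hG, hj2, neg_zero]
    have hA : Pᵀ * G * Q = 0 := by
      apply eq_of_dot
      intro x y
      have hx : ∀ x y : Fin 4 → ℝ, x ⬝ᵥ ((Pᵀ * G * Q) *ᵥ y) = (P *ᵥ x) ⬝ᵥ (G *ᵥ (Q *ᵥ y)) := by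
        intro x y
        rw [← Matrix.mulVec_mulVec, ← Matrix.mulVec_mulVec, Matrix.dotProduct_mulVec,
          Matrix.vecMul_transpose]
      have : Pᵀ * G * Q = 0 := by
        funext k l
        have : (Pᵀ * G * Q) k l = Pi.single k 1 ⬝ᵥ ((Pᵀ * G * Q) *ᵥ Pi.single l 1) := by simp
        rw [this, hx]
        rcases hcov k with rfl | rfl | rfl | rfl
        · exact hi1 _
        · exact hj1 _
        · rcases hcov l with rfl | rfl | rfl | rfl
          · exact hi2 _
          · exact hj2 _
          · exact hG _
          · exact h0
        · rcases hcov l with rfl | rfl | rfl | rfl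
          · exact hi2 _
          · exact hj2 _
          · exact hts
          · exact hG _
      rw [this]
    apply eq_of_dot
    intro x y
    obtain ⟨v, rfl⟩ := surj_of_rank hPr x
    obtain ⟨u, rfl⟩ := surj_of_rank hQr y
    have : (P *ᵥ v) ⬝ᵥ (G *ᵥ (Q *ᵥ u)) = v ⬝ᵥ ((Pᵀ * G * Q) *ᵥ u) := by
      rw [← Matrix.mulVec_mulVec, ← Matrix.mulVec_mulVec, Matrix.dotProduct_mulVec v,
          Matrix.vecMul_transpose]
    rw [this, hA]
    simp
  have hf : (P *ᵥ (Pi.single s 1)) ⬝ᵥ (F *ᵥ (Q *ᵥ (Pi.single t 1))) ≠ 0 :=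
    fun h0 => hF (key F h h0)
  have hg : (P *ᵥ (Pi.single s 1)) ⬝ᵥ (psi P Q *ᵥ (Q *ᵥ (Pi.single t 1))) ≠ 0 := by
    rw [psi_spec]
    intro h0
    obtain ⟨v, a, b, hne, h1, h2⟩ := (det_bigMat_eq_zero _ _ _ _).1 h0
    rw [← Matrix.mulVec_smul, ← Matrix.mulVec_add] at h1 h2
    have h1 := hP _ h1
    have h2 := hQ _ h2
    have e1 := h1 j hij.symm
    have e2 := h1 s his.symm
    have e3 := h1 t hit.symm
    have f1 := h2 i hij
    have f2 := h2 s hjs.symm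
    have f3 := h2 t hjt.symm
    simp [hij, his, hit, hjs, hjt, hst, hij.symm, his.symm, hit.symm, hjs.symm, hjt.symm,
      hst.symm] at e1 e2 e3 f1 f2 f3
    rw [f2] at e2
    rw [e3] at f3
    simp at e2 f3
    rcases hne with h | h | h
    · apply h
      funext k
      rcases hcov k with rfl | rfl | rfl | rfl <;> simpa
    · exact h e2
    · exact h f3
  set f := (P *ᵥ (Pi.single s 1)) ⬝ᵥ (F *ᵥ (Q *ᵥ (Pi.single t 1))) with hfd
  set g := (P *ᵥ (Pi.single s 1)) ⬝ᵥ (psi P Q *ᵥ (Q *ᵥ (Pi.single t 1))) with hgd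
  refine ⟨g / f, div_ne_zero hg hf, ?_⟩
  rw [← sub_eq_zero]
  apply key
  · intro c
    rw [Matrix.sub_mulVec, Matrix.smul_mulVec, dotProduct_sub, dotProduct_smul, h, psi_alt]
    simp
  · rw [Matrix.sub_mulVec, Matrix.smul_mulVec, dotProduct_sub, dotProduct_smul, ← hfd, ← hgd]
    simp [hf]

lemma forward (F : Fin 4 → Fin 4 → Matrix (Fin 3) (Fin 3) ℝ)
    (hsym : ∀ i j, F j i = (F i j)ᵀ)
    (hrank : ∀ i j, i ≠ j → (F i j).rank = 2)
    (e : Fin 4 → Fin 4 → (Fin 3 → ℝ))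
    (he : ∀ i j, i ≠ j → e i j ≠ 0 ∧ F i j *ᵥ e i j = 0)
    (hC : Compat4 F) :
    ∃ ν : Fin 4 → Fin 4 → ℝ, (∀ i j, i ≠ j → ν i j ≠ 0) ∧
      ∀ i j s t, i ≠ j → i ≠ s → j ≠ s → i ≠ t → j ≠ t →
        ν s i * ν t j * (e s i ⬝ᵥ (F i j *ᵥ e t j)) =
          - (ν t i * ν s j * (e t i ⬝ᵥ (F i j *ᵥ e s j))) := by
  obtain ⟨P, lam, hcam, hP⟩ := hC
  have hlt : ∀ i j, i < j → ∀ c, (P i *ᵥ c) ⬝ᵥ (F i j *ᵥ (P j *ᵥ c)) = 0 := by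
    intro i j hij c
    obtain ⟨h0, h1⟩ := hP i j hij
    have := psi_alt (P i) (P j) c
    rw [← h1, Matrix.smul_mulVec, dotProduct_smul, smul_eq_mul] at this
    exact (mul_eq_zero.1 this).resolve_left h0
  have halt : ∀ i j, i ≠ j → ∀ c, (P i *ᵥ c) ⬝ᵥ (F i j *ᵥ (P j *ᵥ c)) = 0 := by
    intro i j hij c
    rcases lt_or_gt_of_ne hij with h | h
    · exact hlt i j h c
    · rw [hsym j i, dot_transpose]
      exact hlt j i h c
  choose c hc0 hc using fun i => exists_center (P i)
  have hker : ∀ i j, i ≠ j → F i j *ᵥ (P j *ᵥ c i) = 0 := by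
    intro i j hij
    apply dotProduct_eq_zero
    intro x
    obtain ⟨d, rfl⟩ := surj_of_rank (hcam i) x
    rw [dotProduct_comm, alt_skew (halt i j hij), hc]
    simp
  have hne : ∀ i j, i ≠ j → P j *ᵥ c i ≠ 0 := by
    have aux : ∀ i j d, i < j → d ≠ 0 → P i *ᵥ d = 0 → P j *ᵥ d = 0 → False := by
      intro i j d hij hd h1 h2
      have h3 := psi_eq_zero _ _ d hd h1 h2
      obtain ⟨h4, h5⟩ := hP i j hij
      rw [h3] at h5
      have h6 := (smul_eq_zero.1 h5).resolve_left h4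
      have := hrank i j hij.ne
      rw [h6] at this
      simp at this
    intro i j hij h
    rcases lt_or_gt_of_ne hij with h' | h'
    · exact aux i j _ h' (hc0 i) (hc i) h
    · exact aux j i _ h' (hc0 i) h (hc i)
  have hν : ∀ i j, ∃ ν : ℝ, i ≠ j → P j *ᵥ c i = ν • e i j := by
    intro i j
    by_cases hij : i = j
    · exact ⟨0, fun h => absurd hij h⟩
    · obtain ⟨ν, h⟩ := ker_rank2 (hrank i j hij) (he i j hij).1 (he i j hij).2 (hker i j hij)
      exact ⟨ν, fun _ => h⟩
  choose ν hν using hν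
  refine ⟨ν, ?_, ?_⟩
  · intro i j hij h0
    apply hne i j hij
    rw [hν i j hij, h0, zero_smul]
  · intro i j s t hij his hjs hit hjt
    have := alt_skew (halt i j hij) (c s) (c t)
    rw [hν s i his.symm, hν t j hjt.symm, hν t i hit.symm, hν s j hjs.symm] at this
    simp only [Matrix.mulVec_smul, dotProduct_smul, smul_dotProduct, smul_eq_mul] at this
    linarith

lemma solve_nu (a1 a2 a3 a4 a5 a6 b1 b2 b3 b4 b5 b6 : ℝ)
    (ha1 : a1 ≠ 0) (ha2 : a2 ≠ 0) (ha3 : a3 ≠ 0) (ha4 : a4 ≠ 0) (ha5 : a5 ≠ 0) (ha6 : a6 ≠ 0)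
    (hb1 : b1 ≠ 0) (hb2 : b2 ≠ 0) (hb3 : b3 ≠ 0) (hb4 : b4 ≠ 0) (hb5 : b5 ≠ 0) (hb6 : b6 ≠ 0)
    (h : a1 * a2 * a3 * a4 * a5 * a6 = b1 * b2 * b3 * b4 * b5 * b6) :
    ∃ n12 n13 n23 n31 n32 : ℝ, n12 ≠ 0 ∧ n13 ≠ 0 ∧ n23 ≠ 0 ∧ n31 ≠ 0 ∧ n32 ≠ 0 ∧
      a1 + n31 * b1 = 0 ∧ n12 * b2 + n32 * a2 = 0 ∧ n13 * a3 + n23 * b3 = 0 ∧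
      n31 * a4 + n32 * b4 = 0 ∧ n23 * a5 + b5 = 0 ∧ n12 * a6 + n13 * b6 = 0 := by
  refine ⟨a1 / b1 * (a4 / b4) * -(a2 / b2), a1 / b1 * (a4 / b4) * (a2 / b2) * (a6 / b6), -(b5 / a5),
    -(a1 / b1), a1 / b1 * (a4 / b4), ?_, ?_, ?_, ?_, ?_, ?_, ?_, ?_, ?_, ?_, ?_⟩
  any_goals first | positivity | (simp [*]; done)
  all_goals field_simp
  all_goals first | (ring; done) | linear_combination h

theorem backward (F : Fin 4 → Fin 4 → Matrix (Fin 3) (Fin 3) ℝ)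
    (hsym : ∀ i j, F j i = (F i j)ᵀ)
    (hrank : ∀ i j, i ≠ j → (F i j).rank = 2)
    (e : Fin 4 → Fin 4 → (Fin 3 → ℝ))
    (he : ∀ i j, i ≠ j → e i j ≠ 0 ∧ F i j *ᵥ e i j = 0)
    (hindep : ∀ i j k l : Fin 4, i ≠ j → i ≠ k → i ≠ l → j ≠ k → j ≠ l → k ≠ l →
      LinearIndependent ℝ ![e j i, e k i, e l i])
    (hcond : ∀ i j k : Fin 4, i ≠ j → i ≠ k → j ≠ k → e k i ⬝ᵥ (F i j *ᵥ e k j) = 0)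
    (ν : Fin 4 → Fin 4 → ℝ) (hν0 : ∀ i j, i ≠ j → ν i j ≠ 0)
    (hν : ∀ i j s t, i < j → i ≠ s → j ≠ s → i ≠ t → j ≠ t → s ≠ t →
        ν s i * ν t j * (e s i ⬝ᵥ (F i j *ᵥ e t j)) +
          ν t i * ν s j * (e t i ⬝ᵥ (F i j *ᵥ e s j)) = 0) : Compat4 F := by
  have hleft : ∀ i j y, i ≠ j → e j i ⬝ᵥ (F i j *ᵥ y) = 0 := by
    intro i j y hij
    rw [hsym j i, dot_transpose, (he j i hij.symm).2]
    simp
  let N : Fin 4 → Fin 4 → Fin 3 → ℝ := fun k i => if k = i then 0 else ν k i • e k i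
  let P : Fin 4 → Matrix (Fin 3) (Fin 4) ℝ := fun i a k => N k i a
  have hPv : ∀ i v, P i *ᵥ v = ∑ k, v k • N k i := by
    intro i v
    funext a
    simp [Matrix.mulVec, dotProduct, P, mul_comm]
  have hN0 : ∀ i, N i i = 0 := by intro i; simp [N]
  have hN1 : ∀ k i, k ≠ i → N k i = ν k i • e k i := by intro k i h; simp [N, h]
  have hPs : ∀ i, P i *ᵥ Pi.single i 1 = 0 := by
    intro i
    rw [hPv, Finset.sum_eq_single i] <;> simp +contextual [hN0]
  have hPk : ∀ i v, P i *ᵥ v = 0 → ∀ k, k ≠ i → v k = 0 := by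
    have aux : ∀ i j s t : Fin 4, i ≠ j → i ≠ s → i ≠ t → j ≠ s → j ≠ t → s ≠ t → ∀ v : Fin 4 → ℝ,
        v j • N j i + v s • N s i + v t • N t i = 0 → v j = 0 ∧ v s = 0 ∧ v t = 0 := by
      intro i j s t hij his hit hjs hjt hst v h
      rw [hN1 j i hij.symm, hN1 s i his.symm, hN1 t i hit.symm] at h
      simp only [smul_smul] at h
      have hl := Fintype.linearIndependent_iff.1 (hindep i j s t hij his hit hjs hjt hst)
        ![v j * ν j i, v s * ν s i, v t * ν t i] (by simpa [Fin.sum_univ_succ, add_assoc] using h)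
      have h0 := hl 0
      have h1 := hl 1
      have h2 := hl 2
      simp [hν0 _ _ hij.symm, hν0 _ _ his.symm, hν0 _ _ hit.symm] at h0 h1 h2
      exact ⟨h0, h1, h2⟩
    intro i v h k hk
    rw [hPv, Fin.sum_univ_four] at h
    fin_cases i
    · have := aux 0 1 2 3 (by decide) (by decide) (by decide) (by decide) (by decide) (by decide) v
        (by simpa [hN0] using h)
      fin_cases k <;> first
        | exact absurd rfl hk | exact this.1 | exact this.2.1 | exact this.2.2
    · have := aux 1 0 2 3 (by decide) (by decide) (by decide) (by decide) (by decide) (by decide) v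
        (by simpa [hN0] using h)
      fin_cases k <;> first
        | exact absurd rfl hk | exact this.1 | exact this.2.1 | exact this.2.2
    · have := aux 2 0 1 3 (by decide) (by decide) (by decide) (by decide) (by decide) (by decide) v
        (by simpa [hN0] using h)
      fin_cases k <;> first
        | exact absurd rfl hk | exact this.1 | exact this.2.1 | exact this.2.2
    · have := aux 3 0 1 2 (by decide) (by decide) (by decide) (by decide) (by decide) (by decide) v
        (by simpa [hN0] using h)
      fin_cases k <;> first
        | exact absurd rfl hk | exact this.1 | exact this.2.1 | exact this.2.2
  have hPr : ∀ i, (P i).rank = 3 := by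
    intro i
    have hle : LinearMap.ker (P i).mulVecLin ≤ Submodule.span ℝ {Pi.single i 1} := by
      intro v hv
      rw [Submodule.mem_span_singleton]
      refine ⟨v i, ?_⟩
      have := hPk i v (by simpa using hv)
      funext k
      by_cases hk : k = i
      · subst hk; simp
      · simp [hk, this k hk]
    have h1 := (Submodule.finrank_mono hle).trans (finrank_span_singleton (K := ℝ) (v := (Pi.single i 1 : Fin 4 → ℝ))
      (by simp)).le
    have h2 := LinearMap.finrank_range_add_finrank_ker (P i).mulVecLin
    have h3 := (P i).rank_le_height
    rw [← Matrix.rank] at h2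
    simp at h2
    omega
  have hA : ∀ i j, i < j → ∀ k l, N k i ⬝ᵥ (F i j *ᵥ N l j) + N l i ⬝ᵥ (F i j *ᵥ N k j) = 0 := by
    intro i j hij
    have hi : ∀ l, N i i ⬝ᵥ (F i j *ᵥ N l j) + N l i ⬝ᵥ (F i j *ᵥ N i j) = 0 := by
      intro l
      rw [hN0, hN1 i j hij.ne, Matrix.mulVec_smul, (he i j hij.ne).2]; simp
    have hj : ∀ l, N j i ⬝ᵥ (F i j *ᵥ N l j) + N l i ⬝ᵥ (F i j *ᵥ N j j) = 0 := by
      intro l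
      rw [hN0, hN1 j i hij.ne', smul_dotProduct, hleft i j _ hij.ne]; simp
    intro k l
    by_cases hki : k = i
    · subst hki; exact hi l
    by_cases hkj : k = j
    · subst hkj; exact hj l
    by_cases hli : l = i
    · subst hli; rw [add_comm]; exact hi k
    by_cases hlj : l = j
    · subst hlj; rw [add_comm]; exact hj k
    rw [hN1 k i hki, hN1 l i hli, hN1 k j hkj, hN1 l j hlj]
    simp only [Matrix.mulVec_smul, dotProduct_smul, smul_dotProduct, smul_eq_mul]
    by_cases hkl : k = l
    · subst hkl
      rw [hcond i j k hij.ne (Ne.symm hki) (Ne.symm hkj)]; simp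
    · have := hν i j k l hij (Ne.symm hki) (Ne.symm hkj) (Ne.symm hli) (Ne.symm hlj) hkl
      linarith
  have halt : ∀ i j, i < j → ∀ c, (P i *ᵥ c) ⬝ᵥ (F i j *ᵥ (P j *ᵥ c)) = 0 := by
    intro i j hij c
    have h1 : (P i *ᵥ c) ⬝ᵥ (F i j *ᵥ (P j *ᵥ c)) =
        ∑ k, ∑ l, c k * c l * (N k i ⬝ᵥ (F i j *ᵥ N l j)) := by
      rw [hPv, hPv, sum_dotProduct]
      refine Finset.sum_congr rfl fun k _ => ?_
      rw [Matrix.mulVec_sum, dotProduct_sum]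
      refine Finset.sum_congr rfl fun l _ => ?_
      simp only [Matrix.mulVec_smul, dotProduct_smul, smul_dotProduct, smul_eq_mul]
      ring
    have h2 : (P i *ᵥ c) ⬝ᵥ (F i j *ᵥ (P j *ᵥ c)) =
        ∑ k, ∑ l, c k * c l * (N l i ⬝ᵥ (F i j *ᵥ N k j)) := by
      rw [h1, Finset.sum_comm]
      refine Finset.sum_congr rfl fun k _ => Finset.sum_congr rfl fun l _ => ?_
      ring
    have h3 : (P i *ᵥ c) ⬝ᵥ (F i j *ᵥ (P j *ᵥ c)) + (P i *ᵥ c) ⬝ᵥ (F i j *ᵥ (P j *ᵥ c)) = 0 := by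
      nth_rewrite 1 [h1]
      rw [h2, ← Finset.sum_add_distrib]
      refine Finset.sum_eq_zero fun k _ => ?_
      rw [← Finset.sum_add_distrib]
      refine Finset.sum_eq_zero fun l _ => ?_
      rw [← mul_add, hA i j hij, mul_zero]
    linarith
  have hlam : ∀ i j, ∃ l : ℝ, i < j → l ≠ 0 ∧ l • F i j = psi (P i) (P j) := by
    intro i j
    by_cases hij : i < j
    swap
    · exact ⟨0, fun h => absurd h hij⟩
    have hex : ∀ i j : Fin 4, i < j → ∃ s t, (∀ k, k = i ∨ k = j ∨ k = s ∨ k = t) ∧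
        i ≠ s ∧ i ≠ t ∧ j ≠ s ∧ j ≠ t ∧ s ≠ t := by decide
    obtain ⟨s, t, hcov, his, hit, hjs, hjt, hst⟩ := hex i j hij
    have hF : F i j ≠ 0 := by
      intro h0
      have := hrank i j hij.ne
      rw [h0] at this
      simp at this
    obtain ⟨l, hl⟩ := pair_lemma i j s t hcov hij.ne his hit hjs hjt hst hF (hPr i) (hPr j)
      (hPs i) (hPs j) (hPk i) (hPk j) (halt i j hij)
    exact ⟨l, fun _ => hl⟩
  choose lam hlam using hlam
  exact ⟨P, lam, hPr, hlam⟩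

/-- Case 1.  Here `e i j` denotes the epipole `e_j^i`
(superscript `i`, subscript `j`), so the epipolar number
`𝐞_{sijt} = (e_i^s)ᵀ F^{ij} e_j^t` is `e s i ⬝ᵥ (F i j *ᵥ e t j)`. -/
theorem stmt12 (F : Fin 4 → Fin 4 → Matrix (Fin 3) (Fin 3) ℝ)
    (hsym : ∀ i j, F j i = (F i j)ᵀ)
    (hrank : ∀ i j, i ≠ j → (F i j).rank = 2)
    (e : Fin 4 → Fin 4 → (Fin 3 → ℝ))
    (he : ∀ i j, i ≠ j → e i j ≠ 0 ∧ F i j *ᵥ e i j = 0)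
    (hindep : ∀ i j k l : Fin 4, i ≠ j → i ≠ k → i ≠ l → j ≠ k → j ≠ l → k ≠ l →
      LinearIndependent ℝ ![e j i, e k i, e l i]) :
    Compat4 F ↔
      ((∀ i j k : Fin 4, i ≠ j → i ≠ k → j ≠ k →
          e k i ⬝ᵥ (F i j *ᵥ e k j) = 0) ∧
        (e 3 0 ⬝ᵥ (F 0 1 *ᵥ e 2 1)) * (e 1 0 ⬝ᵥ (F 0 2 *ᵥ e 3 2)) *
            (e 2 0 ⬝ᵥ (F 0 3 *ᵥ e 1 3)) * (e 3 1 ⬝ᵥ (F 1 2 *ᵥ e 0 2)) *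
            (e 0 1 ⬝ᵥ (F 1 3 *ᵥ e 2 3)) * (e 1 2 ⬝ᵥ (F 2 3 *ᵥ e 0 3)) =
          (e 2 0 ⬝ᵥ (F 0 1 *ᵥ e 3 1)) * (e 3 0 ⬝ᵥ (F 0 2 *ᵥ e 1 2)) *
            (e 1 0 ⬝ᵥ (F 0 3 *ᵥ e 2 3)) * (e 0 1 ⬝ᵥ (F 1 2 *ᵥ e 3 2)) *
            (e 2 1 ⬝ᵥ (F 1 3 *ᵥ e 0 3)) * (e 0 2 ⬝ᵥ (F 2 3 *ᵥ e 1 3))) := by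
  constructor
  · intro hC
    obtain ⟨ν, h0, h⟩ := forward F hsym hrank e he hC
    constructor
    · intro i j k hij hik hjk
      have := h i j k k hij hik hjk hik hjk
      have h2 : ν k i * ν k j * (e k i ⬝ᵥ (F i j *ᵥ e k j)) = 0 := by linarith
      exact (mul_eq_zero.1 h2).resolve_left (mul_ne_zero (h0 _ _ hik.symm) (h0 _ _ hjk.symm))
    · have g1 := h 0 1 3 2 (by decide) (by decide) (by decide) (by decide) (by decide)
      have g2 := h 0 2 1 3 (by decide) (by decide) (by decide) (by decide) (by decide)
      have g3 := h 0 3 2 1 (by decide) (by decide) (by decide) (by decide) (by decide)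
      have g4 := h 1 2 3 0 (by decide) (by decide) (by decide) (by decide) (by decide)
      have g5 := h 1 3 0 2 (by decide) (by decide) (by decide) (by decide) (by decide)
      have g6 := h 2 3 1 0 (by decide) (by decide) (by decide) (by decide) (by decide)
      have hne : ν 0 1 * ν 0 2 * ν 0 3 * ν 1 0 * ν 1 2 * ν 1 3 * ν 2 0 * ν 2 1 * ν 2 3 *
          ν 3 0 * ν 3 1 * ν 3 2 ≠ 0 := by
        have := h0 0 1 (by decide)
        have := h0 0 2 (by decide)
        have := h0 0 3 (by decide)
        have := h0 1 0 (by decide)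
        have := h0 1 2 (by decide)
        have := h0 1 3 (by decide)
        have := h0 2 0 (by decide)
        have := h0 2 1 (by decide)
        have := h0 2 3 (by decide)
        have := h0 3 0 (by decide)
        have := h0 3 1 (by decide)
        have := h0 3 2 (by decide)
        positivity
      apply mul_left_cancel₀ hne
      have hp := congrArg₂ (· * ·) (congrArg₂ (· * ·) (congrArg₂ (· * ·) g1 g2)
        (congrArg₂ (· * ·) g3 g4)) (congrArg₂ (· * ·) g5 g6)
      generalize e 3 0 ⬝ᵥ (F 0 1 *ᵥ e 2 1) = a1 at *
      generalize e 1 0 ⬝ᵥ (F 0 2 *ᵥ e 3 2) = a2 at *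
      generalize e 2 0 ⬝ᵥ (F 0 3 *ᵥ e 1 3) = a3 at *
      generalize e 3 1 ⬝ᵥ (F 1 2 *ᵥ e 0 2) = a4 at *
      generalize e 0 1 ⬝ᵥ (F 1 3 *ᵥ e 2 3) = a5 at *
      generalize e 1 2 ⬝ᵥ (F 2 3 *ᵥ e 0 3) = a6 at *
      generalize e 2 0 ⬝ᵥ (F 0 1 *ᵥ e 3 1) = b1 at *
      generalize e 3 0 ⬝ᵥ (F 0 2 *ᵥ e 1 2) = b2 at *
      generalize e 1 0 ⬝ᵥ (F 0 3 *ᵥ e 2 3) = b3 at *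
      generalize e 0 1 ⬝ᵥ (F 1 2 *ᵥ e 3 2) = b4 at *
      generalize e 2 1 ⬝ᵥ (F 1 3 *ᵥ e 0 3) = b5 at *
      generalize e 0 2 ⬝ᵥ (F 2 3 *ᵥ e 1 3) = b6 at *
      linear_combination hp
  · rintro ⟨hcond, hprod⟩
    have hE : ∀ i j s t, i ≠ j → i ≠ s → j ≠ s → i ≠ t → j ≠ t → s ≠ t →
        e s i ⬝ᵥ (F i j *ᵥ e t j) ≠ 0 := by
      intro i j s t hij his hjs hit hjt hst h0
      have hz : F i j *ᵥ e t j = 0 := by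
        apply indep_dot (hindep i j s t hij his hit hjs hjt hst) _ h0
          (hcond i j t hij hit hjt)
        rw [hsym j i, dot_transpose, (he j i hij.symm).2]
        simp
      obtain ⟨c, hc⟩ := ker_rank2 (hrank i j hij) (he i j hij).1 (he i j hij).2 hz
      have hl := Fintype.linearIndependent_iff.1
        (hindep j i t s hij.symm hjt hjs hit his hst.symm) ![c, -1, 0]
        (by simp [Fin.sum_univ_succ, hc]) 1
      simp at hl
    obtain ⟨n12, n13, n23, n31, n32, h12, h13, h23, h31, h32, q1, q2, q3, q4, q5, q6⟩ :=
      solve_nu _ _ _ _ _ _ _ _ _ _ _ _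
        (hE 0 1 3 2 (by decide) (by decide) (by decide) (by decide) (by decide) (by decide))
        (hE 0 2 1 3 (by decide) (by decide) (by decide) (by decide) (by decide) (by decide))
        (hE 0 3 2 1 (by decide) (by decide) (by decide) (by decide) (by decide) (by decide))
        (hE 1 2 3 0 (by decide) (by decide) (by decide) (by decide) (by decide) (by decide))
        (hE 1 3 0 2 (by decide) (by decide) (by decide) (by decide) (by decide) (by decide))
        (hE 2 3 1 0 (by decide) (by decide) (by decide) (by decide) (by decide) (by decide))
        (hE 0 1 2 3 (by decide) (by decide) (by decide) (by decide) (by decide) (by decide))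
        (hE 0 2 3 1 (by decide) (by decide) (by decide) (by decide) (by decide) (by decide))
        (hE 0 3 1 2 (by decide) (by decide) (by decide) (by decide) (by decide) (by decide))
        (hE 1 2 0 3 (by decide) (by decide) (by decide) (by decide) (by decide) (by decide))
        (hE 1 3 2 0 (by decide) (by decide) (by decide) (by decide) (by decide) (by decide))
        (hE 2 3 0 1 (by decide) (by decide) (by decide) (by decide) (by decide) (by decide))
        hprod
    refine backward F hsym hrank e he hindep hcond
      ![![1, 1, 1, 1], ![1, 1, n12, n13], ![1, 1, 1, n23], ![1, n31, n32, 1]] ?_ ?_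
    · intro i j hij
      fin_cases i <;> fin_cases j <;>
        first | exact absurd rfl hij | (simp [h12, h13, h23, h31, h32]; done)
    · intro i j s t hij his hjs hit hjt hst
      clear hE hprod hcond hindep he hrank hsym
      fin_cases i <;> fin_cases j <;> first
        | (exfalso; revert hij; decide)
        | (fin_cases s <;> first
            | (exfalso; revert his; decide)
            | (exfalso; revert hjs; decide)
            | (fin_cases t <;> first
                | (exfalso; revert hit; decide)
                | (exfalso; revert hjt; decide)
                | (exfalso; revert hst; decide)
                | (simp; linarith)))
end
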